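/- For every k ≥ 1 there exists a constant C = C(k) > 0 such that: for every measurable A ⊆ ℝ^k with 0 < |A| < ∞ and every δ ∈ [0,1), if |A+A| ≤ (2^k+δ)|A| then |co(A) \ A| ≤ C·δ·|A|. -/

import Mathlib

open Set Pointwise MeasureTheory

theorem prime_cells_le_cthickening {X : Set ℝ} (hX : X ⊆ Icc 0 1) (hne : X.Nonempty)
    (p : ℕ) (hp : p.Prime) :
    min 1 (2 * volume.real X - 1 / p) ≤
      volume.real (Metric.cthickening (2 / p) ((X + X) ∪ ((X + X) + {-1})) ∩ Icc 0 1) := by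
  classical
  have : Fact p.Prime := ⟨hp⟩
  have hp0 : (0 : ℝ) < p := by exact_mod_cast hp.pos
  set W := (X + X) ∪ ((X + X) + {-1}) with hW
  let I : Finset (ZMod p) := Finset.univ.filter
    (fun i => (X ∩ Icc ((i.val : ℝ) / p) ((i.val + 1) / p)).Nonempty)
  have hcov : X ⊆ ⋃ i ∈ I, Icc ((i.val : ℝ) / p) ((i.val + 1) / p) := by
    intro x hx
    have hx01 := hX hx
    by_cases h1 : x = 1
    · have hv : (((p - 1 : ℕ) : ZMod p)).val = p - 1 :=
        ZMod.val_cast_of_lt (Nat.sub_lt hp.pos one_pos)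
      have hc : (((p - 1 : ℕ) : ℝ)) = p - 1 := by
        rw [Nat.cast_sub hp.one_le]; simp
      have hm : x ∈ Icc (((((p - 1 : ℕ) : ZMod p)).val : ℝ) / p)
          (((((p - 1 : ℕ) : ZMod p)).val + 1) / p) := by
        rw [hv, hc, h1]
        constructor
        · rw [div_le_one hp0]; linarith
        · rw [le_div_iff₀ hp0]; linarith
      simp only [mem_iUnion]
      exact ⟨_, Finset.mem_filter.2 ⟨Finset.mem_univ _, x, hx, hm⟩, hm⟩
    · have hlt : x < 1 := lt_of_le_of_ne hx01.2 h1
      have hf : ⌊x * p⌋₊ < p := by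
        rw [Nat.floor_lt (by have := hx01.1; positivity)]
        nlinarith
      have hv : ((⌊x * p⌋₊ : ℕ) : ZMod p).val = ⌊x * p⌋₊ := ZMod.val_cast_of_lt hf
      have hm : x ∈ Icc ((((⌊x * p⌋₊ : ℕ) : ZMod p).val : ℝ) / p)
          ((((⌊x * p⌋₊ : ℕ) : ZMod p).val + 1) / p) := by
        rw [hv]
        constructor
        · rw [div_le_iff₀ hp0]; exact Nat.floor_le (by have := hx01.1; positivity)
        · rw [le_div_iff₀ hp0]; exact (Nat.lt_floor_add_one _).le
      simp only [mem_iUnion]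
      exact ⟨_, Finset.mem_filter.2 ⟨Finset.mem_univ _, x, hx, hm⟩, hm⟩
  have hXI : volume.real X ≤ I.card / p := by
    calc volume.real X ≤ volume.real (⋃ i ∈ I, Icc ((i.val : ℝ) / p) ((i.val + 1) / p)) := by
          refine measureReal_mono hcov ?_
          refine ((measure_biUnion_finset_le _ _).trans_lt ?_).ne
          exact ENNReal.sum_lt_top.2 fun i _ => by simp
      _ ≤ ∑ i ∈ I, volume.real (Icc ((i.val : ℝ) / p) ((i.val + 1) / p)) :=
          measureReal_biUnion_finset_le _ _
      _ = I.card / p := by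
          rw [Finset.sum_congr rfl (g := fun _ => 1 / (p : ℝ))]
          · rw [Finset.sum_const]; simp [div_eq_mul_inv]
          · intro i _
            rw [Real.volume_real_Icc_of_le (by gcongr; linarith)]
            field_simp; ring
  have hIne : I.Nonempty := by
    obtain ⟨x, hx⟩ := hne
    have := hcov hx
    simp only [mem_iUnion] at this
    obtain ⟨i, hi, _⟩ := this
    exact ⟨i, hi⟩
  have hcd := ZMod.cauchy_davenport hp hIne hIne
  have hsub : (⋃ r ∈ I + I, Ico ((r.val : ℝ) / p) ((r.val + 1) / p)) ⊆
      Metric.cthickening (2 / p) W ∩ Icc 0 1 := by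
    intro t ht
    simp only [mem_iUnion] at ht
    obtain ⟨r, hr, ht⟩ := ht
    obtain ⟨i, hi, j, hj, rfl⟩ := Finset.mem_add.1 hr
    simp only [I, Finset.mem_filter, Finset.mem_univ, true_and] at hi hj
    obtain ⟨x, hx, hxi⟩ := hi
    obtain ⟨y, hy, hyj⟩ := hj
    have hi1 := (div_le_iff₀ hp0).1 hxi.1
    have hi2 := (le_div_iff₀ hp0).1 hxi.2
    have hj1 := (div_le_iff₀ hp0).1 hyj.1
    have hj2 := (le_div_iff₀ hp0).1 hyj.2
    have ht1 := (div_le_iff₀ hp0).1 ht.1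
    have ht2 := (lt_div_iff₀ hp0).1 ht.2
    have hval : ((i + j).val : ℝ) + 1 ≤ p := by exact_mod_cast ZMod.val_lt (i + j)
    refine ⟨?_, ?_, ?_⟩
    · by_cases hlt : i.val + j.val < p
      · rw [ZMod.val_add_of_lt hlt] at ht1 ht2
        push_cast at ht1 ht2
        refine Metric.mem_cthickening_of_dist_le t (x + y) _ _ (Or.inl (add_mem_add hx hy)) ?_
        rw [Real.dist_eq, abs_le, neg_le, le_div_iff₀ hp0, le_div_iff₀ hp0]
        constructor <;> nlinarith
      · have he := ZMod.val_add_val_of_le (not_lt.1 hlt)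
        have he' : (i.val : ℝ) + j.val = (i + j).val + p := by exact_mod_cast he
        refine Metric.mem_cthickening_of_dist_le t (x + y + -1) _ _
          (Or.inr (add_mem_add (add_mem_add hx hy) rfl)) ?_
        rw [Real.dist_eq, abs_le, neg_le, le_div_iff₀ hp0, le_div_iff₀ hp0]
        constructor <;> nlinarith
    · exact le_trans (by positivity) ht.1
    · nlinarith
  have hdisj : volume.real (⋃ r ∈ I + I, Ico ((r.val : ℝ) / p) ((r.val + 1) / p)) =
      (I + I).card / p := by
    rw [measureReal_biUnion_finset (h := fun i _ => by
      rw [Real.volume_Ico]; exact ENNReal.ofReal_ne_top)]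
    · rw [Finset.sum_congr rfl (g := fun _ => 1 / (p : ℝ))]
      · rw [Finset.sum_const]; simp [div_eq_mul_inv]
      · intro i _
        rw [Real.volume_real_Ico_of_le (by gcongr; linarith)]
        field_simp; ring
    · intro i _ j _ hij
      rw [Function.onFun, Set.disjoint_left]
      intro t hti htj
      apply hij
      apply ZMod.val_injective
      have a1 := (div_le_iff₀ hp0).1 hti.1
      have a2 := (lt_div_iff₀ hp0).1 hti.2
      have b1 := (div_le_iff₀ hp0).1 htj.1
      have b2 := (lt_div_iff₀ hp0).1 htj.2
      have c1 : (i.val : ℝ) < j.val + 1 := by linarith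
      have c2 : (j.val : ℝ) < i.val + 1 := by linarith
      have c1' : i.val < j.val + 1 := by exact_mod_cast c1
      have c2' : j.val < i.val + 1 := by exact_mod_cast c2
      omega
    · intro i _; exact measurableSet_Ico
  have hfin : volume (Metric.cthickening (2 / p) W ∩ Icc 0 1) ≠ ⊤ :=
    ((measure_mono inter_subset_right).trans_lt (by simp)).ne
  have hcard : (min (p : ℝ) (2 * I.card - 1)) ≤ (I + I).card := by
    have h1 : 1 ≤ I.card := hIne.card_pos
    rcases le_total p (I.card + I.card - 1) with h | h
    · rw [min_eq_left h] at hcd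
      exact (min_le_left _ _).trans (by exact_mod_cast hcd)
    · rw [min_eq_right h] at hcd
      refine (min_le_right _ _).trans ?_
      have : I.card + I.card ≤ (I + I).card + 1 := by omega
      have : (I.card : ℝ) + I.card ≤ (I + I).card + 1 := by exact_mod_cast this
      linarith
  calc min 1 (2 * volume.real X - 1 / p) ≤ min (p : ℝ) (2 * I.card - 1) / p := by
        rw [le_div_iff₀ hp0]
        have := (le_div_iff₀ hp0).1 hXI
        refine le_min ?_ ?_
        · nlinarith [min_le_left (1 : ℝ) (2 * volume.real X - 1 / p)]
        · have h2 := min_le_right (1 : ℝ) (2 * volume.real X - 1 / p)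
          have h3 := mul_le_mul_of_nonneg_right h2 hp0.le
          have h4 : (2 * volume.real X - 1 / p) * p = 2 * (volume.real X * p) - 1 := by
            field_simp
          linarith
    _ ≤ (I + I).card / p := by gcongr
    _ = _ := hdisj.symm
    _ ≤ _ := measureReal_mono hsub hfin

/-- Raikov's inequality on the circle for `X + X`. -/
theorem min_le_volume_add_self_mod_one {X : Set ℝ} (hX : X ⊆ Icc 0 1) (hc : IsCompact X) :
    min 1 (2 * volume.real X) ≤
      volume.real (((X + X) ∪ ((X + X) + {-1})) ∩ Icc 0 1) := by
  rcases X.eq_empty_or_nonempty with rfl | hne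
  · simp
  set W := (X + X) ∪ ((X + X) + {-1}) with hW
  have hWc : IsClosed W :=
    ((hc.add hc).union ((hc.add hc).add isCompact_singleton)).isClosed
  choose q hq1 hq2 using fun n : ℕ => Nat.exists_infinite_primes (n + 1)
  have hfin : ∃ R > 0, (volume.restrict (Icc (0 : ℝ) 1)) (Metric.cthickening R W) ≠ ⊤ :=
    ⟨1, one_pos, (measure_lt_top _ _).ne⟩
  have ht := tendsto_measure_cthickening_of_isClosed hfin hWc
  have hq0 : Filter.Tendsto (fun n => (1 : ℝ) / q n) Filter.atTop (nhds 0) := by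
    refine squeeze_zero (fun n => by positivity) (fun n => ?_) tendsto_one_div_add_atTop_nhds_zero_nat
    exact one_div_le_one_div_of_le (by positivity) (by exact_mod_cast hq1 n)
  have hq0' : Filter.Tendsto (fun n => (2 : ℝ) / q n) Filter.atTop (nhds 0) := by
    have := hq0.const_mul 2
    simpa only [mul_one_div, mul_zero] using this
  have h1 := (ENNReal.tendsto_toReal (measure_lt_top _ _).ne).comp (ht.comp hq0')
  have h2 : Filter.Tendsto (fun n => min 1 (2 * volume.real X - 1 / q n)) Filter.atTop
      (nhds (min 1 (2 * volume.real X - 0))) :=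
    tendsto_const_nhds.min (tendsto_const_nhds.sub hq0)
  have h3 := le_of_tendsto_of_tendsto h2 h1 (Filter.Eventually.of_forall fun n => by
    have := prime_cells_le_cthickening hX hne (q n) (hq2 n)
    simpa only [Function.comp_apply, Measure.restrict_apply' measurableSet_Icc, Measure.real] using this)
  simpa only [sub_zero, Measure.restrict_apply' measurableSet_Icc, Measure.real] using h3

theorem min_add_le_volume {X Y Z : Set ℝ} (hX : X ⊆ Icc 0 1) (hc : IsCompact X)
    (hY : Y ⊆ Icc 0 1) (hZ : IsCompact Z) (hXZ : X + X ⊆ Z) (hYZ : Y ⊆ Z)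
    (hYZ' : Y + {1} ⊆ Z) :
    min 1 (2 * volume X) + volume Y ≤ volume Z := by
  have hZm : MeasurableSet Z := hZ.measurableSet
  set Z0 := Z ∩ Icc 0 1 with hZ0
  set Z1 := ((fun t => t + 1) ⁻¹' Z) ∩ Icc 0 1 with hZ1
  have hZ0m : MeasurableSet Z0 := hZm.inter measurableSet_Icc
  have hZ1m : MeasurableSet Z1 := (hZm.preimage (by fun_prop)).inter measurableSet_Icc
  have hXf : volume X ≠ ⊤ := hc.measure_lt_top.ne
  have h1 : min 1 (2 * volume X) ≤ volume (Z0 ∪ Z1) := by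
    have h := min_le_volume_add_self_mod_one hX hc
    have hsub : ((X + X) ∪ ((X + X) + {-1})) ∩ Icc 0 1 ⊆ Z0 ∪ Z1 := by
      rintro t ⟨ht | ht, ht01⟩
      · exact Or.inl ⟨hXZ ht, ht01⟩
      · obtain ⟨u, hu, v, hv, rfl⟩ := ht
        rw [mem_singleton_iff] at hv
        subst hv
        refine Or.inr ⟨?_, ht01⟩
        simpa using hXZ hu
    have hfin : volume (Z0 ∪ Z1) ≠ ⊤ :=
      ((measure_mono (union_subset inter_subset_right inter_subset_right)).trans_lt
        (by simp : volume (Icc (0:ℝ) 1) < ⊤)).ne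
    have h' := h.trans (measureReal_mono hsub hfin)
    rw [← ENNReal.ofReal_toReal hfin, ← ENNReal.ofReal_toReal hXf]
    refine le_trans (le_of_eq ?_) (ENNReal.ofReal_le_ofReal h')
    rw [ENNReal.ofReal_min, ENNReal.ofReal_mul zero_le_two]
    simp [Measure.real]
  have h2 : volume Y ≤ volume (Z0 ∩ Z1) := measure_mono fun t ht =>
    ⟨⟨hYZ ht, hY ht⟩, hYZ' (add_mem_add ht rfl), hY ht⟩
  have h3 : volume (Z0 ∪ Z1) + volume (Z0 ∩ Z1) = volume Z0 + volume Z1 :=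
    measure_union_add_inter _ hZ1m
  have h4 : volume Z0 ≤ volume (Z ∩ Iic 1) := measure_mono fun t ht => ⟨ht.1, ht.2.2⟩
  have h5 : volume Z1 ≤ volume (Z \ Iic 1) := by
    calc volume Z1 ≤ volume ((fun t => t + (1:ℝ)) ⁻¹' (Z \ Iic 1) ∪ {0}) := by
          apply measure_mono
          rintro t ⟨ht, ht01⟩
          rcases eq_or_lt_of_le ht01.1 with h | h
          · exact Or.inr h.symm
          · exact Or.inl ⟨ht, by simp [h]⟩
      _ ≤ volume ((fun t => t + (1:ℝ)) ⁻¹' (Z \ Iic 1)) + volume {(0:ℝ)} := measure_union_le _ _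
      _ = volume (Z \ Iic 1) := by
          rw [measure_preimage_add_right]; simp
  calc _ ≤ _ := add_le_add h1 h2
    _ = _ := h3
    _ ≤ _ := add_le_add h4 h5
    _ = _ := measure_inter_add_sdiff _ measurableSet_Iic

theorem two_mul_add_diff_translate_le {X : Set ℝ} (hc : IsCompact X) (hne : X.Nonempty)
    {s : ℝ} (hs : 0 ≤ s) :
    2 * volume X + volume (X \ (X + {s})) ≤ volume (X + X) + ENNReal.ofReal s := by
  have ha := hc.sInf_mem hne
  have hb := hc.sSup_mem hne
  have hsub : X ⊆ Icc (sInf X) (sSup X) := fun x hx =>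
    ⟨csInf_le hc.bddBelow hx, le_csSup hc.bddAbove hx⟩
  set a := sInf X
  set b := sSup X
  have hab : a ≤ b := (hsub ha).2
  have hXf : volume X ≠ ⊤ := hc.measure_lt_top.ne
  have hd : volume (X \ (X + {s})) ≤ volume X := measure_mono sdiff_subset
  have hdL : volume (X \ (X + {s})) + volume X ≤ ENNReal.ofReal s + ENNReal.ofReal (b - a) := by
    have h1 : X \ (X + {s}) ⊆ Icc a (a + s) ∪ (fun t => t - s) ⁻¹' (Icc a b \ X) := by
      rintro t ⟨ht, hts⟩
      by_cases h : t ≤ a + s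
      · exact Or.inl ⟨(hsub ht).1, h⟩
      · refine Or.inr ⟨⟨by simp; linarith, ?_⟩, fun h' => hts ⟨t - s, h', s, rfl, by simp⟩⟩
        have := (hsub ht).2
        simp; linarith
    have h2 : volume (X \ (X + {s})) ≤ ENNReal.ofReal s + volume (Icc a b \ X) := by
      refine (measure_mono h1).trans ((measure_union_le _ _).trans ?_)
      simp_rw [sub_eq_add_neg]
      rw [measure_preimage_add_right]; simp
    have h3 : volume (Icc a b \ X) + volume X = ENNReal.ofReal (b - a) := by
      rw [← Real.volume_Icc, ← measure_inter_add_sdiff (Icc a b) hc.measurableSet,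
        inter_eq_self_of_subset_right hsub, add_comm]
    calc _ ≤ ENNReal.ofReal s + volume (Icc a b \ X) + volume X := by gcongr
      _ = _ := by rw [add_assoc, h3]
  rcases eq_or_lt_of_le hab with h | h
  · have : volume X = 0 := le_antisymm ((measure_mono hsub).trans (by simp [h])) zero_le
    rw [this] at hd ⊢
    rw [le_antisymm hd zero_le]; simp
  have hL : 0 < b - a := sub_pos.2 h
  have hmain : min (ENNReal.ofReal (b - a)) (2 * volume X) + volume X ≤ volume (X + X) := by
    set c := (b - a)⁻¹ with hcdef
    have hc0 : 0 < c := inv_pos.2 hL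
    set g : ℝ → ℝ := fun x => c * (x - a) with hg
    have hgc : Continuous g := by fun_prop
    have hvol : ∀ (T : Set ℝ) (e : ℝ), ENNReal.ofReal (b - a) * volume ((fun x => c * (x - e)) '' T)
        = volume T := by
      intro T e
      have : (fun x => c * (x - e)) '' T = c • ((fun x => x - e) '' T) := by
        rw [← image_smul, image_image]; rfl
      rw [this, Measure.addHaar_smul]
      have h2 : volume ((fun x => x - e) '' T) = volume T := by
        simp [sub_eq_add_neg, measure_preimage_add_right]
      rw [h2, ← mul_assoc, ← ENNReal.ofReal_mul hL.le]
      simp [hcdef, abs_of_pos hL, hL.ne']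
    have hY : g '' X ⊆ Icc 0 1 := by
      rintro _ ⟨x, hx, rfl⟩
      have := hsub hx
      refine ⟨mul_nonneg hc0.le (by linarith [this.1]), ?_⟩
      calc c * (x - a) ≤ c * (b - a) := by gcongr; exact this.2
        _ = 1 := inv_mul_cancel₀ hL.ne'
    have hYc : IsCompact (g '' X) := hc.image hgc
    have h0 : (0:ℝ) ∈ g '' X := ⟨a, ha, by simp [hg]⟩
    have h1 : (1:ℝ) ∈ g '' X := ⟨b, hb, inv_mul_cancel₀ hL.ne'⟩
    have key := min_add_le_volume hY hYc hY (hYc.add hYc) subset_rfl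
      (fun t ht => ⟨t, ht, 0, h0, add_zero t⟩)
      (add_subset_add_left (singleton_subset_iff.2 h1))
    have hsum : g '' X + g '' X = (fun x => c * (x - 2 * a)) '' (X + X) := by
      ext t
      constructor
      · rintro ⟨_, ⟨x, hx, rfl⟩, _, ⟨y, hy, rfl⟩, rfl⟩
        exact ⟨x + y, add_mem_add hx hy, by simp [hg]; ring⟩
      · rintro ⟨_, ⟨x, hx, y, hy, rfl⟩, rfl⟩
        exact ⟨_, ⟨x, hx, rfl⟩, _, ⟨y, hy, rfl⟩, by simp [hg]; ring⟩
    rw [hsum] at key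
    have := mul_le_mul_right key (ENNReal.ofReal (b - a))
    rw [hvol, mul_add, hvol] at this
    refine le_trans ?_ this
    gcongr
    rw [mul_min, mul_one, mul_left_comm, hvol]
  rcases le_total (2 * volume X) (ENNReal.ofReal (b - a)) with h2 | h2
  · rw [min_eq_right h2] at hmain
    calc _ ≤ 2 * volume X + volume X := by gcongr
      _ ≤ _ := hmain
      _ ≤ _ := le_self_add
  · rw [min_eq_left h2] at hmain
    calc 2 * volume X + volume (X \ (X + {s})) = (volume (X \ (X + {s})) + volume X) + volume X := by
          ring
      _ ≤ ENNReal.ofReal s + ENNReal.ofReal (b - a) + volume X := by gcongr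
      _ = ENNReal.ofReal (b - a) + volume X + ENNReal.ofReal s := by ring
      _ ≤ _ := by gcongr

instance isAddHaarMeasure_volume_prod (n : ℕ) :
    (volume : Measure (ℝ × (Fin n → ℝ))).IsAddHaarMeasure := by
  rw [Measure.volume_eq_prod]; infer_instance

theorem exists_volume_image_eq_mul {V V' : Type*} [NormedAddCommGroup V] [NormedSpace ℝ V]
    [FiniteDimensional ℝ V] [MeasureSpace V] [BorelSpace V] [(volume : Measure V).IsAddHaarMeasure]
    [NormedAddCommGroup V'] [NormedSpace ℝ V'] [FiniteDimensional ℝ V'] [MeasureSpace V']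
    [BorelSpace V'] [(volume : Measure V').IsAddHaarMeasure] (g : V ≃ₗ[ℝ] V') :
    ∃ κ : ENNReal, κ ≠ 0 ∧ κ ≠ ⊤ ∧ ∀ S : Set V, volume (g '' S) = κ * volume S := by
  let e : V ≃L[ℝ] V' := g.toContinuousLinearEquiv
  let m : V' ≃ᵐ V := e.symm.toHomeomorph.toMeasurableEquiv
  have hm : (Measure.map m (volume : Measure V')).IsAddHaarMeasure :=
    e.symm.isAddHaarMeasure_map volume
  have h := Measure.isAddLeftInvariant_eq_smul (Measure.map m (volume : Measure V')) volume
  refine ⟨(Measure.addHaarScalarFactor (Measure.map m (volume : Measure V')) volume : ENNReal),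
    ?_, ENNReal.coe_ne_top, fun S => ?_⟩
  · exact_mod_cast (Measure.addHaarScalarFactor_pos_of_isAddHaarMeasure _ _).ne'
  · have h2 : Measure.map m (volume : Measure V') S = volume (g '' S) := by
      rw [m.map_apply]
      congr 1
      exact (e.toEquiv.image_eq_preimage_symm S).symm
    rw [← h2]
    conv_lhs => rw [h]
    rfl

theorem lintegral_comp_const_smul {n : ℕ} (F : (Fin n → ℝ) → ENNReal) :
    ∫⁻ x, F ((2⁻¹ : ℝ) • x) = 2 ^ n * ∫⁻ x, F x := by
  let m : (Fin n → ℝ) ≃ᵐ (Fin n → ℝ) :=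
    (Homeomorph.smulOfNeZero (2⁻¹ : ℝ) (by norm_num)).toMeasurableEquiv
  have h1 : ∫⁻ x, F ((2⁻¹ : ℝ) • x) = ∫⁻ x, F x ∂(Measure.map m volume) :=
    (lintegral_map_equiv F m).symm
  have h2 : Measure.map m (volume : Measure (Fin n → ℝ)) = (2 ^ n : ENNReal) • volume := by
    have := Measure.map_addHaar_smul (volume : Measure (Fin n → ℝ)) (r := 2⁻¹) (by norm_num)
    have hc : ENNReal.ofReal |((2⁻¹ : ℝ) ^ Module.finrank ℝ (Fin n → ℝ))⁻¹| = 2 ^ n := by simp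
    rw [hc] at this
    exact this
  rw [h1, h2, lintegral_smul_measure]; rfl

theorem isCompact_fiber {E : Type*} [TopologicalSpace E] [T2Space E] {A : Set (ℝ × E)}
    (hA : IsCompact A) (h : E) :
    IsCompact ((fun t : ℝ => (t, h)) ⁻¹' A) :=
  (hA.image continuous_fst).of_isClosed_subset (hA.isClosed.preimage (by fun_prop))
    fun t ht => ⟨(t, h), ht, rfl⟩

theorem volume_add_lintegral_min_le {n : ℕ} {A : Set (ℝ × (Fin n → ℝ))} (hA : IsCompact A)
    (hsub : A ⊆ Icc 0 1 ×ˢ univ) (h0 : (0, 0) ∈ A) (h1 : (1, 0) ∈ A) :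
    2 ^ n * (∫⁻ h, min 1 (2 * volume ((fun t : ℝ => (t, h)) ⁻¹' A))) + volume A ≤
      volume (A + A) := by
  have hm : MeasurableSet A := hA.measurableSet
  have hAA := hA.add hA
  rw [Measure.volume_eq_prod, Measure.prod_apply_symm hAA.measurableSet,
    Measure.prod_apply_symm hm, ← lintegral_comp_const_smul
      (fun h => min 1 (2 * volume ((fun t : ℝ => (t, h)) ⁻¹' A))),
    ← lintegral_add_right _ (measurable_measure_prodMk_right hm)]
  refine lintegral_mono fun s => ?_
  refine min_add_le_volume (fun t ht => (hsub ht).1) (isCompact_fiber hA _)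
    (fun t ht => (hsub ht).1) (isCompact_fiber hAA _) ?_ ?_ ?_
  · rintro _ ⟨a, ha, b, hb, rfl⟩
    refine ⟨_, ha, _, hb, ?_⟩
    ext1
    · rfl
    · simp [← two_smul ℝ, smul_smul]
  · intro t ht
    exact ⟨_, ht, _, h0, by simp⟩
  · rintro _ ⟨t, ht, _, rfl, rfl⟩
    exact ⟨_, ht, _, h1, by simp⟩

theorem exists_fiber_gt_half {n : ℕ} {A : Set (ℝ × (Fin n → ℝ))} (hA : IsCompact A)
    (hsub : A ⊆ Icc 0 1 ×ˢ univ) (h0 : (0, 0) ∈ A) (h1 : (1, 0) ∈ A)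
    (hd : volume (A + A) < (2 ^ (n + 1) + 1) * volume A) :
    ∃ h, 2⁻¹ < volume ((fun t : ℝ => (t, h)) ⁻¹' A) := by
  by_contra! hcon
  refine hd.not_ge ?_
  have hm : MeasurableSet A := hA.measurableSet
  refine le_trans (le_of_eq ?_) (volume_add_lintegral_min_le hA hsub h0 h1)
  have : ∀ h, min 1 (2 * volume ((fun t : ℝ => (t, h)) ⁻¹' A)) =
      2 * volume ((fun t : ℝ => (t, h)) ⁻¹' A) := fun h => min_eq_right (by
    calc _ ≤ 2 * 2⁻¹ := mul_le_mul_right (hcon h) 2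
      _ = (1 : ENNReal) := ENNReal.mul_inv_cancel two_ne_zero ENNReal.ofNat_ne_top)
  simp_rw [this]
  rw [lintegral_const_mul _ (measurable_measure_prodMk_right hm),
    ← Measure.prod_apply_symm hm, ← Measure.volume_eq_prod]
  ring

theorem volume_snd_image_le {n : ℕ} {A : Set (ℝ × (Fin n → ℝ))} (hA : IsCompact A)
    (hsub : A ⊆ Icc 0 1 ×ˢ univ) (h0 : (0, 0) ∈ A) (h1 : (1, 0) ∈ A)
    (hd : volume (A + A) < (2 ^ (n + 1) + 1) * volume A) :
    volume (Prod.snd '' A) ≤ 2 * volume (A + A) := by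
  obtain ⟨h, hh⟩ := exists_fiber_gt_half hA hsub h0 h1 hd
  have hAA := hA.add hA
  have hS : MeasurableSet ((fun x => x - h) ⁻¹' (Prod.snd '' A)) :=
    (hA.image continuous_snd).measurableSet.preimage (by fun_prop)
  have key : 2⁻¹ * volume (Prod.snd '' A) ≤ volume (A + A) := by
    rw [Measure.volume_eq_prod ℝ (Fin n → ℝ), Measure.prod_apply_symm hAA.measurableSet]
    calc 2⁻¹ * volume (Prod.snd '' A)
        = ∫⁻ _ in (fun x => x - h) ⁻¹' (Prod.snd '' A), 2⁻¹ := by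
          rw [setLIntegral_const]
          simp_rw [sub_eq_add_neg]
          rw [measure_preimage_add_right]
      _ ≤ ∫⁻ y in (fun x => x - h) ⁻¹' (Prod.snd '' A),
          volume ((fun t : ℝ => (t, y)) ⁻¹' (A + A)) := by
          refine setLIntegral_mono' hS fun y hy => hh.le.trans ?_
          obtain ⟨⟨u, v⟩, hx, hv⟩ := hy
          dsimp only at hv
          calc _ = volume ((fun t => t + (-u)) ⁻¹' ((fun t : ℝ => (t, h)) ⁻¹' A)) := by
                rw [measure_preimage_add_right]
            _ ≤ _ := by
                refine measure_mono fun t ht => ⟨_, ht, _, hx, ?_⟩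
                ext1
                · simp
                · simp [hv]
      _ ≤ _ := setLIntegral_le_lintegral _ _
  calc volume (Prod.snd '' A) = 2 * (2⁻¹ * volume (Prod.snd '' A)) := by
        rw [← mul_assoc, ENNReal.mul_inv_cancel two_ne_zero ENNReal.ofNat_ne_top, one_mul]
    _ ≤ _ := by gcongr

section AffineImage

variable {V V' : Type*} [NormedAddCommGroup V] [NormedSpace ℝ V]
    [FiniteDimensional ℝ V] [MeasureSpace V] [BorelSpace V] [(volume : Measure V).IsAddHaarMeasure]
    [NormedAddCommGroup V'] [NormedSpace ℝ V'] [FiniteDimensional ℝ V'] [MeasureSpace V']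
    [BorelSpace V'] [(volume : Measure V').IsAddHaarMeasure]

theorem exists_volume_affine_image_eq_mul (g : V ≃ₗ[ℝ] V') (p : V) :
    ∃ κ : ENNReal, κ ≠ 0 ∧ κ ≠ ⊤ ∧
      (∀ S : Set V, volume ((fun x => g (x - p)) '' S) = κ * volume S) ∧
      ∀ S : Set V, volume ((fun x => g (x - p)) '' S + (fun x => g (x - p)) '' S) =
        κ * volume (S + S) := by
  obtain ⟨κ, h0, ht, h⟩ := exists_volume_image_eq_mul g
  have key : ∀ (p : V) (S : Set V), volume ((fun x => g (x - p)) '' S) = κ * volume S := by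
    intro p S
    have : (fun x => g (x - p)) '' S = g '' ((fun x => x + -p) '' S) := by
      rw [image_image]; simp [sub_eq_add_neg]
    rw [this, h, image_add_right, measure_preimage_add_right]
  refine ⟨κ, h0, ht, key p, fun S => ?_⟩
  rw [← key (p + p)]
  congr 1
  ext t
  constructor
  · rintro ⟨_, ⟨x, hx, rfl⟩, _, ⟨y, hy, rfl⟩, rfl⟩
    exact ⟨x + y, add_mem_add hx hy, by simp only [← map_add]; congr 1; abel⟩
  · rintro ⟨_, ⟨x, hx, y, hy, rfl⟩, rfl⟩
    exact ⟨_, ⟨x, hx, rfl⟩, _, ⟨y, hy, rfl⟩, by simp only [← map_add]; congr 1; abel⟩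

end AffineImage

theorem exists_normalizing_shear {n : ℕ} {A : Set (ℝ × (Fin n → ℝ))} (hA : IsCompact A)
    (hpos : 0 < volume A) :
    ∃ (g : (ℝ × (Fin n → ℝ)) ≃ₗ[ℝ] (ℝ × (Fin n → ℝ))) (p : ℝ × (Fin n → ℝ)) (w : ℝ),
      0 < w ∧ (∀ x, (g x).1 = x.1 / w) ∧ (∀ x ∈ A, ∀ y ∈ A, x.1 - y.1 ≤ w) ∧
      (fun x => g (x - p)) '' A ⊆ Icc 0 1 ×ˢ univ ∧
      (0, 0) ∈ (fun x => g (x - p)) '' A ∧ (1, 0) ∈ (fun x => g (x - p)) '' A := by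
  have hne : A.Nonempty := nonempty_of_measure_ne_zero hpos.ne'
  obtain ⟨p, hp, hpm⟩ := hA.exists_isMinOn hne continuous_fst.continuousOn
  obtain ⟨q, hq, hqm⟩ := hA.exists_isMaxOn hne continuous_fst.continuousOn
  have hpm' : ∀ x ∈ A, p.1 ≤ x.1 := fun x hx => hpm hx
  have hqm' : ∀ x ∈ A, x.1 ≤ q.1 := fun x hx => hqm hx
  have hw : 0 < q.1 - p.1 := by
    by_contra! hcon
    have hsub : A ⊆ {p.1} ×ˢ univ := fun x hx =>
      ⟨le_antisymm ((hqm' x hx).trans (by linarith)) (hpm' x hx), trivial⟩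
    have : volume A ≤ 0 := (measure_mono hsub).trans (by
      rw [Measure.volume_eq_prod, Measure.prod_prod]; simp)
    exact hpos.not_ge this
  set w := q.1 - p.1 with hwdef
  set d := q.2 - p.2 with hddef
  let g : (ℝ × (Fin n → ℝ)) ≃ₗ[ℝ] (ℝ × (Fin n → ℝ)) :=
    { toFun := fun x => (x.1 / w, x.2 - (x.1 / w) • d)
      invFun := fun x => (x.1 * w, x.2 + x.1 • d)
      map_add' := fun x y => by
        ext1
        · simp [add_div]
        · simp [add_div, add_smul]; abel
      map_smul' := fun r x => by
        ext1
        · simp [mul_div_assoc]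
        · simp [mul_div_assoc, mul_smul, smul_sub]
      left_inv := fun x => by
        ext1
        · simp [hw.ne']
        · simp
      right_inv := fun x => by
        ext1
        · simp [hw.ne']
        · simp [hw.ne'] }
  refine ⟨g, p, w, hw, fun x => rfl, fun x hx y hy => ?_, ?_, ⟨p, hp, by simp; rfl⟩, ⟨q, hq, ?_⟩⟩
  · linarith [hpm' y hy, hqm' x hx]
  · rintro _ ⟨x, hx, rfl⟩
    refine ⟨⟨div_nonneg ?_ hw.le, (div_le_one hw).2 ?_⟩, trivial⟩
    · simpa using hpm' x hx
    · simpa [hwdef] using hqm' x hx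
  · change ((q - p).1 / w, (q - p).2 - ((q - p).1 / w) • d) = _
    have h1 : (q - p).1 = w := rfl
    have h2 : (q - p).2 = d := rfl
    rw [h1, h2, div_self hw.ne', one_smul, sub_self]

theorem width_mul_volume_le_prod {n : ℕ} {A A' : Set (ℝ × (Fin n → ℝ))} (hA : IsCompact A)
    (hpos : 0 < volume A) (hd : volume (A + A) < (2 ^ (n + 1) + 1) * volume A)
    (hsub : A' ⊆ A) {b : ℝ} (hb : ∀ x ∈ A', x.1 ∈ Icc b (b + 2))
    {x y : ℝ × (Fin n → ℝ)} (hx : x ∈ A) (hy : y ∈ A) :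
    ENNReal.ofReal (x.1 - y.1) * volume A' ≤ 4 * volume (A + A) := by
  obtain ⟨g, p, w, hw, hg, hwid, hB, h0, h1⟩ := exists_normalizing_shear hA hpos
  obtain ⟨κ, hκ0, hκt, hκ, hκ2⟩ := exists_volume_affine_image_eq_mul g p
  set φ : ℝ × (Fin n → ℝ) → ℝ × (Fin n → ℝ) := fun x => g (x - p) with hφ
  have hφc : Continuous φ :=
    (g.toContinuousLinearEquiv.continuous).comp (continuous_id.sub continuous_const)
  have hs := volume_snd_image_le (hA.image hφc) hB h0 h1 (by
    rw [hκ, hκ2, mul_left_comm]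
    exact ENNReal.mul_lt_mul_right hκ0 hκt hd)
  have hB' : volume (φ '' A') ≤ ENNReal.ofReal (2 / w) * volume (Prod.snd '' (φ '' A)) := by
    calc volume (φ '' A')
        ≤ volume (Icc ((b - p.1) / w) ((b + 2 - p.1) / w) ×ˢ (Prod.snd '' (φ '' A))) := by
          apply measure_mono
          rintro _ ⟨z, hz, rfl⟩
          refine ⟨?_, ⟨_, ⟨z, hsub hz, rfl⟩, rfl⟩⟩
          have := hb z hz
          simp only [hφ, hg, Prod.fst_sub]
          exact ⟨by gcongr; exact this.1, by gcongr; exact this.2⟩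
      _ = _ := by
          rw [Measure.volume_eq_prod, Measure.prod_prod, Real.volume_Icc]
          congr 2
          field_simp; ring
  have h4 : κ * volume A' ≤ κ * (ENNReal.ofReal (2 / w) * (2 * volume (A + A))) := by
    calc _ = _ := (hκ A').symm
      _ ≤ _ := hB'
      _ ≤ ENNReal.ofReal (2 / w) * (2 * volume (φ '' A + φ '' A)) := by gcongr
      _ = _ := by rw [hκ2]; ring
  rw [ENNReal.mul_le_mul_iff_right hκ0 hκt] at h4
  calc ENNReal.ofReal (x.1 - y.1) * volume A'
      ≤ ENNReal.ofReal w * (ENNReal.ofReal (2 / w) * (2 * volume (A + A))) := by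
        gcongr
        exact hwid x hx y hy
    _ = ENNReal.ofReal 2 * (2 * volume (A + A)) := by
        rw [← mul_assoc, ← ENNReal.ofReal_mul hw.le, mul_div_cancel₀ _ hw.ne']
    _ = _ := by
        rw [← mul_assoc, ENNReal.ofReal_ofNat]; norm_num

/-- Splitting off the `i`-th coordinate, as a linear equivalence. -/
def splitCoord {n : ℕ} (i : Fin (n + 1)) : (Fin (n + 1) → ℝ) ≃ₗ[ℝ] (ℝ × (Fin n → ℝ)) where
  toFun x := (x i, i.removeNth x)
  invFun y := i.insertNth y.1 y.2
  map_add' _ _ := rfl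
  map_smul' _ _ := rfl
  left_inv x := by simp
  right_inv y := by simp

theorem width_mul_volume_le {n : ℕ} {A A' : Set (Fin (n + 1) → ℝ)} (hA : IsCompact A)
    (hpos : 0 < volume A) (hd : volume (A + A) < (2 ^ (n + 1) + 1) * volume A)
    (hsub : A' ⊆ A) (i : Fin (n + 1)) {b : ℝ}
    (hb : ∀ x ∈ A', x i ∈ Icc b (b + 2))
    {x y : Fin (n + 1) → ℝ} (hx : x ∈ A) (hy : y ∈ A) :
    ENNReal.ofReal (x i - y i) * volume A' ≤ 4 * volume (A + A) := by
  obtain ⟨κ, hκ0, hκt, hκ⟩ := exists_volume_image_eq_mul (splitCoord (n := n) i)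
  have hc : Continuous (splitCoord (n := n) i) :=
    (splitCoord i).toContinuousLinearEquiv.continuous
  have hadd : splitCoord i '' A + splitCoord i '' A = splitCoord i '' (A + A) :=
    (image_add (splitCoord i)).symm
  have := width_mul_volume_le_prod (hA.image hc) (by rw [hκ]; positivity)
    (by rw [hadd, hκ, hκ, mul_left_comm]; exact ENNReal.mul_lt_mul_right hκ0 hκt hd)
    (image_mono hsub) (b := b) (by rintro _ ⟨z, hz, rfl⟩; exact hb z hz)
    (mem_image_of_mem _ hx) (mem_image_of_mem _ hy)
  rw [hadd, hκ, hκ, mul_left_comm, mul_left_comm 4, ENNReal.mul_le_mul_iff_right hκ0 hκt] at this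
  exact this

theorem volume_add_volume_le_real {X Y : Set ℝ} (hX : IsCompact X) (hY : IsCompact Y)
    (hXn : X.Nonempty) (hYn : Y.Nonempty) : volume X + volume Y ≤ volume (X + Y) := by
  have ha := hX.sInf_mem hXn
  have hb := hY.sSup_mem hYn
  have hX' : ∀ x ∈ X, sInf X ≤ x := fun x hx => csInf_le hX.bddBelow hx
  have hY' : ∀ y ∈ Y, y ≤ sSup Y := fun y hy => le_csSup hY.bddAbove hy
  set a := sInf X
  set b := sSup Y
  have h1 : volume Y ≤ volume ((X + Y) ∩ Iic (a + b)) := by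
    calc volume Y = volume ((fun t => t + -a) ⁻¹' Y) := by rw [measure_preimage_add_right]
      _ ≤ _ := by
          refine measure_mono fun t ht => ⟨⟨a, ha, _, ht, by simp⟩, ?_⟩
          have := hY' _ ht
          rw [mem_Iic]; linarith
  have h2 : volume X ≤ volume ((X + Y) \ Iic (a + b)) := by
    calc volume X = volume ((fun t => t + -b) ⁻¹' X) := by rw [measure_preimage_add_right]
      _ ≤ volume (((X + Y) \ Iic (a + b)) ∪ {a + b}) := by
          refine measure_mono fun t ht => ?_
          by_cases h : t = a + b
          · exact Or.inr h
          · refine Or.inl ⟨⟨_, ht, b, hb, by simp⟩, fun hle => h (le_antisymm hle ?_)⟩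
            have := hX' _ ht
            linarith
      _ ≤ _ := measure_union_le _ _
      _ = _ := by simp
  rw [← measure_inter_add_sdiff (X + Y) (measurableSet_Iic (a := a + b)), add_comm]
  exact add_le_add h1 h2

/-- Doubling estimate for the superlevel sets of the fiber length. -/
theorem lintegral_superlevel_add_le {n : ℕ} {B : Set (ℝ × (Fin n → ℝ))} (hB : IsCompact B)
    {F : ℝ → Set (Fin n → ℝ)}
    (hF : ∀ l, F l = {h | ENNReal.ofReal l ≤ volume ((fun t : ℝ => (t, h)) ⁻¹' B)}) :
    volume B = ∫⁻ l in Ioi 0, volume (F l) ∧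
      2 * ∫⁻ l in Ioi 0, volume (F l + F l) ≤ volume (B + B) := by
  have hcake : ∀ {C : Set (ℝ × (Fin n → ℝ))}, IsCompact C → volume C =
      ∫⁻ l in Ioi 0, volume {h | ENNReal.ofReal l ≤ volume ((fun t : ℝ => (t, h)) ⁻¹' C)} := by
    intro C hC
    have hm := hC.measurableSet
    have hfin : ∀ h, volume ((fun t : ℝ => (t, h)) ⁻¹' C) ≠ ⊤ :=
      fun h => (isCompact_fiber hC h).measure_lt_top.ne
    conv_lhs => rw [Measure.volume_eq_prod, Measure.prod_apply_symm hm]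
    have := lintegral_eq_lintegral_meas_le (volume : Measure (Fin n → ℝ))
      (f := fun h => (volume ((fun t : ℝ => (t, h)) ⁻¹' C)).toReal)
      (Filter.Eventually.of_forall fun h => ENNReal.toReal_nonneg)
      (measurable_measure_prodMk_right hm).ennreal_toReal.aemeasurable
    simp_rw [ENNReal.ofReal_toReal (hfin _)] at this
    rw [this]
    refine setLIntegral_congr_fun measurableSet_Ioi fun l hl => ?_
    simp only [ENNReal.ofReal_le_iff_le_toReal (hfin _)]
  refine ⟨by simp_rw [hF]; exact hcake hB, ?_⟩
  rw [hcake (hB.add hB)]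
  set M : ℝ → ENNReal := fun l =>
    volume {h | ENNReal.ofReal l ≤ volume ((fun t : ℝ => (t, h)) ⁻¹' (B + B))} with hM
  have hscale : ∫⁻ l in Ioi 0, M l = 2 * ∫⁻ l in Ioi 0, M (2 * l) := by
    let m : ℝ ≃ᵐ ℝ := (Homeomorph.mulLeft₀ (2 : ℝ) two_ne_zero).toMeasurableEquiv
    have h1 : ∫⁻ l in Ioi 0, M (2 * l) = ∫⁻ l, M l ∂(Measure.map m (volume.restrict (Ioi 0))) :=
      (lintegral_map_equiv M m).symm
    have h2 : Measure.map m (volume.restrict (Ioi 0)) =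
        ENNReal.ofReal |(2 : ℝ)⁻¹| • volume.restrict (Ioi 0) := by
      have h3 : (Ioi 0 : Set ℝ) = m ⁻¹' (Ioi 0) := by
        ext t; simp [m]
      conv_lhs => rw [h3]
      rw [← Measure.restrict_map m.measurable measurableSet_Ioi,
        ← Measure.restrict_smul]
      congr 1
      exact Real.map_volume_mul_left two_ne_zero
    rw [h1, h2, lintegral_smul_measure, smul_eq_mul, ← mul_assoc, abs_of_pos (by norm_num),
      ← ENNReal.ofReal_ofNat, ← ENNReal.ofReal_mul (by norm_num)]
    norm_num
  rw [hscale]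
  gcongr 2 * ?_
  refine setLIntegral_mono' measurableSet_Ioi fun l hl => ?_
  simp only [hM]
  refine measure_mono ?_
  have hl0 : (0 : ℝ) < l := hl
  rintro _ ⟨h, hh, h', hh', rfl⟩
  rw [hF] at hh hh'
  have hpos : 0 < ENNReal.ofReal l := by simpa using hl0
  refine le_trans ?_ ((volume_add_volume_le_real (isCompact_fiber hB h) (isCompact_fiber hB h')
    (nonempty_of_measure_ne_zero (hpos.trans_le hh).ne')
    (nonempty_of_measure_ne_zero (hpos.trans_le hh').ne')).trans (measure_mono ?_))
  · rw [two_mul, ENNReal.ofReal_add hl0.le hl0.le]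
    exact add_le_add hh hh'
  · rintro _ ⟨x, hx, y, hy, rfl⟩
    exact ⟨_, hx, _, hy, rfl⟩

theorem two_pow_mul_volume_le_volume_add_self {n : ℕ} (F : Set (Fin n → ℝ)) :
    2 ^ n * volume F ≤ volume (F + F) := by
  calc 2 ^ n * volume F = volume ((2 : ℝ) • F) := by
        rw [Measure.addHaar_smul]; simp
    _ ≤ _ := measure_mono (by
        rintro _ ⟨x, hx, rfl⟩
        exact ⟨x, hx, x, hx, (two_smul ℝ x).symm⟩)

theorem exists_compact_superlevel {n : ℕ} {B : Set (ℝ × (Fin n → ℝ))} (hB : IsCompact B)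
    (hsub : B ⊆ Icc 0 1 ×ˢ univ)
    (hd : volume (B + B) < (2 ^ (n + 1) + 1) * volume B)
    (hsnd : volume (Prod.snd '' B) ≤ 2 * volume (B + B)) :
    ∃ F : Set (Fin n → ℝ), IsCompact F ∧
      (∀ h ∈ F, ENNReal.ofReal (8 * (2 ^ (n + 1) + 1))⁻¹ ≤
        volume ((fun t : ℝ => (t, h)) ⁻¹' B)) ∧
      4⁻¹ * volume B < volume F ∧ volume (F + F) < (2 ^ n + 1) * volume F := by
  set c : ℝ := (8 * (2 ^ (n + 1) + 1))⁻¹ with hc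
  have hc0 : 0 < c := by positivity
  have hBf : volume B ≠ ⊤ := hB.measure_lt_top.ne
  obtain ⟨F, hF⟩ : ∃ F : ℝ → Set (Fin n → ℝ),
      ∀ l, F l = {h | ENNReal.ofReal l ≤ volume ((fun t : ℝ => (t, h)) ⁻¹' B)} :=
    ⟨_, fun l => rfl⟩
  obtain ⟨h1, h2⟩ := lintegral_superlevel_add_le hB hF
  have hFm : ∀ l, MeasurableSet (F l) := fun l => by
    rw [hF]
    exact measurableSet_le measurable_const (measurable_measure_prodMk_right hB.measurableSet)
  have hFsnd : ∀ l, 0 < l → volume (F l) ≤ 2 * (2 ^ (n + 1) + 1) * volume B := by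
    intro l hl
    calc volume (F l) ≤ volume (Prod.snd '' B) := by
          refine measure_mono fun h hh => ?_
          rw [hF] at hh
          obtain ⟨t, ht⟩ := nonempty_of_measure_ne_zero
            (lt_of_lt_of_le (by simpa using hl : 0 < ENNReal.ofReal l) hh).ne'
          exact ⟨_, ht, rfl⟩
      _ ≤ 2 * volume (B + B) := hsnd
      _ ≤ 2 * ((2 ^ (n + 1) + 1) * volume B) := by gcongr
      _ = _ := by ring
  obtain ⟨l, hlc, hl1, hlF⟩ : ∃ l, c < l ∧ 4⁻¹ * volume B < volume (F l) ∧
      volume (F l + F l) < (2 ^ n + 1) * volume (F l) := by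
    by_contra! hcon
    have hpt : ∀ l, 0 < l → (2 ^ n + 1) * volume (F l) ≤ volume (F l + F l) +
        ((Iic c).indicator (fun _ => 2 * (2 ^ (n + 1) + 1) * volume B) l +
          (Iic 1).indicator (fun _ => 4⁻¹ * volume B) l) := by
      intro l hl
      have h3 := two_pow_mul_volume_le_volume_add_self (F l)
      rcases le_or_gt l c with h | h
      · rw [add_mul, one_mul, indicator_of_mem (show l ∈ Iic c from h)]
        exact add_le_add h3 ((hFsnd l hl).trans le_self_add)
      rcases le_or_gt l 1 with h' | h'
      · rcases le_or_gt (volume (F l)) (4⁻¹ * volume B) with h'' | h''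
        · rw [add_mul, one_mul, indicator_of_mem (show l ∈ Iic 1 from h')]
          exact add_le_add h3 (h''.trans le_add_self)
        · exact (hcon l h h'').trans le_self_add
      · have : F l = ∅ := by
          rw [hF, eq_empty_iff_forall_notMem]
          intro x hx
          have h5 : volume ((fun t : ℝ => (t, x)) ⁻¹' B) ≤ 1 := by
            calc _ ≤ volume (Icc (0:ℝ) 1) := measure_mono fun t ht => (hsub ht).1
              _ = 1 := by simp
          have h6 : ENNReal.ofReal l ≤ 1 := le_trans hx h5
          rw [ENNReal.ofReal_le_one] at h6
          linarith
        simp [this]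
    have hIntegral := setLIntegral_mono' (μ := (volume : Measure ℝ)) measurableSet_Ioi hpt
    rw [lintegral_const_mul' _ _ (by finiteness), ← h1, lintegral_add_right _ (by
        refine Measurable.add ?_ ?_ <;> exact measurable_const.indicator measurableSet_Iic),
      lintegral_add_right _ (measurable_const.indicator measurableSet_Iic),
      lintegral_indicator measurableSet_Iic, lintegral_indicator measurableSet_Iic,
      setLIntegral_const, setLIntegral_const, Measure.restrict_apply measurableSet_Iic,
      Measure.restrict_apply measurableSet_Iic, inter_comm, inter_comm (Iic (1:ℝ)), Ioi_inter_Iic,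
      Ioi_inter_Iic, Real.volume_Ioc, Real.volume_Ioc, sub_zero, sub_zero, ENNReal.ofReal_one,
      mul_one] at hIntegral
    have hcK : 2 * (2 ^ (n + 1) + 1) * volume B * ENNReal.ofReal c = 4⁻¹ * volume B := by
      have : (2 * (2 ^ (n + 1) + 1) : ENNReal) * ENNReal.ofReal c = 4⁻¹ := by
        have e1 : (2 * (2 ^ (n + 1) + 1) : ENNReal) = ENNReal.ofReal (2 * (2 ^ (n + 1) + 1)) := by
          rw [ENNReal.ofReal_mul (by norm_num), ENNReal.ofReal_add (by positivity) (by norm_num),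
            ENNReal.ofReal_pow (by norm_num)]
          simp
        rw [e1, ← ENNReal.ofReal_mul (by positivity), hc]
        have e2 : 2 * (2 ^ (n + 1) + 1) * (8 * (2 ^ (n + 1) + 1))⁻¹ = (4 : ℝ)⁻¹ := by
          field_simp; norm_num
        rw [e2, ENNReal.ofReal_inv_of_pos (by norm_num)]; simp
      rw [mul_right_comm, this]
    rw [hcK, ← add_mul] at hIntegral
    have h44 : (4⁻¹ + 4⁻¹ : ENNReal) = 2⁻¹ := by
      rw [← two_mul, show (4 : ENNReal) = 2 * 2 by norm_num, ENNReal.mul_inv (by simp) (by simp),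
        ← mul_assoc, ENNReal.mul_inv_cancel (by simp) (by simp), one_mul]
    rw [h44] at hIntegral
    have h3 : 2 * ((2 ^ n + 1) * volume B) ≤ volume (B + B) + volume B := by
      calc _ ≤ 2 * (∫⁻ l in Ioi 0, volume (F l + F l)) + 2 * (2⁻¹ * volume B) := by
            rw [← mul_add]; gcongr
        _ ≤ _ := by
            rw [← mul_assoc 2 2⁻¹, ENNReal.mul_inv_cancel (by simp) (by simp), one_mul]
            gcongr
    have h4 : (2 ^ (n + 1) + 1) * volume B + volume B ≤ volume (B + B) + volume B := by
      refine le_trans (le_of_eq ?_) h3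
      ring
    exact hd.not_ge ((ENNReal.add_le_add_iff_right hBf).1 h4)
  have hKp : (2 ^ n + 1 : ENNReal) ≠ 0 := by positivity
  have hKt : (2 ^ n + 1 : ENNReal) ≠ ⊤ := by finiteness
  have hmax : max (4⁻¹ * volume B) (volume (F l + F l) / (2 ^ n + 1)) < volume (F l) :=
    max_lt hl1 (by rwa [ENNReal.div_lt_iff (Or.inl hKp) (Or.inl hKt), mul_comm])
  obtain ⟨G, hG, hGc, hGl⟩ := (hFm l).exists_lt_isCompact hmax
  refine ⟨G, hGc, fun h hh => ?_, (le_max_left _ _).trans_lt hGl, ?_⟩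
  · have := hG hh
    rw [hF] at this
    exact le_trans (ENNReal.ofReal_le_ofReal hlc.le) this
  · have h7 := (le_max_right _ _).trans_lt hGl
    rw [ENNReal.div_lt_iff (Or.inl hKp) (Or.inl hKt), mul_comm] at h7
    exact (measure_mono (add_subset_add hG hG)).trans_lt h7

theorem exists_normal_form (k : ℕ) :
    ∃ c : ℝ, 0 < c ∧ ∀ A : Set (Fin k → ℝ), IsCompact A → 0 < volume A →
      volume (A + A) < (2 ^ k + 1) * volume A →
      ∃ (f : (Fin k → ℝ) ≃ₗ[ℝ] (Fin k → ℝ)) (a : Fin k → ℝ),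
        (∀ x ∈ A, ‖f x - a‖ ≤ 1) ∧ ENNReal.ofReal c ≤ volume (f '' A) := by
  induction k with
  | zero =>
    refine ⟨1, one_pos, fun A _ hpos _ => ⟨LinearEquiv.refl _ _, 0, fun x _ => ?_, ?_⟩⟩
    · rw [Subsingleton.elim (LinearEquiv.refl ℝ _ x - 0) 0, norm_zero]; exact zero_le_one
    · have hne : A.Nonempty := nonempty_of_measure_ne_zero hpos.ne'
      have : A = univ := by
        ext x
        obtain ⟨y, hy⟩ := hne
        simp [Subsingleton.elim x y, hy]
      subst this
      simp [volume_pi]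
  | succ n ih =>
    obtain ⟨c, hc, ih⟩ := ih
    obtain ⟨κe, hκe0, hκet, hκe⟩ := exists_volume_image_eq_mul (splitCoord (n := n) 0).symm
    set K : ℝ := 2 ^ (n + 1) + 1 with hK
    have hK0 : 0 < K := by positivity
    have hKe : (2 ^ (n + 1) + 1 : ENNReal) = ENNReal.ofReal K := by
      rw [hK, ENNReal.ofReal_add (by positivity) (by norm_num), ENNReal.ofReal_pow (by norm_num)]
      simp
    set c1 : ℝ := (8 * K)⁻¹ with hc1
    have hc10 : 0 < c1 := by positivity
    set W : ℝ := 16 * K / c1 with hW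
    have hW0 : 0 < W := by positivity
    set γ : ENNReal := ENNReal.ofReal (W⁻¹ ^ (n + 1)) * (κe * (ENNReal.ofReal c1 * ENNReal.ofReal c))
      with hγ
    have hγ0 : γ ≠ 0 := by
      have e1 : ENNReal.ofReal (W⁻¹ ^ (n + 1)) ≠ 0 := by
        simp only [ne_eq, ENNReal.ofReal_eq_zero, not_le]; positivity
      have e2 : ENNReal.ofReal c1 ≠ 0 := by simpa using hc10
      have e3 : ENNReal.ofReal c ≠ 0 := by simpa using hc
      rw [hγ]; exact mul_ne_zero e1 (mul_ne_zero hκe0 (mul_ne_zero e2 e3))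
    have hγt : γ ≠ ⊤ := by finiteness
    refine ⟨γ.toReal, ENNReal.toReal_pos hγ0 hγt, fun A hA hpos hd => ?_⟩
    rw [ENNReal.ofReal_toReal hγt]
    -- normalize the first coordinate
    set e := splitCoord (n := n) 0 with he
    have hec : Continuous e := e.toContinuousLinearEquiv.continuous
    obtain ⟨κ₀, hκ₀0, hκ₀t, hκ₀⟩ := exists_volume_image_eq_mul e
    have hadd0 : e '' A + e '' A = e '' (A + A) := (image_add e).symm
    have hpos0 : 0 < volume (e '' A) := by rw [hκ₀]; positivity
    obtain ⟨g, p, w, hw, -, -, hB, h0, h1⟩ := exists_normalizing_shear (hA.image hec) hpos0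
    obtain ⟨κ₁, hκ₁0, hκ₁t, hκ₁, hκ₁2⟩ := exists_volume_affine_image_eq_mul g p
    set B := (fun x => g (x - p)) '' (e '' A) with hBdef
    have hBc : IsCompact B := (hA.image hec).image
      ((g.toContinuousLinearEquiv.continuous).comp (continuous_id.sub continuous_const))
    have hBd : volume (B + B) < (2 ^ (n + 1) + 1) * volume B := by
      rw [hBdef, hκ₁, hκ₁2, hadd0, hκ₀, hκ₀, mul_left_comm _ κ₁ (κ₀ * _),
        mul_left_comm _ κ₀ (volume A)]
      exact ENNReal.mul_lt_mul_right hκ₁0 hκ₁t (ENNReal.mul_lt_mul_right hκ₀0 hκ₀t hd)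
    have hBpos : 0 < volume B := by rw [hBdef, hκ₁]; positivity
    have hBf : volume B ≠ ⊤ := hBc.measure_lt_top.ne
    -- normalize the remaining coordinates
    obtain ⟨F, hFc, hFB, hFvol, hFd⟩ := exists_compact_superlevel hBc hB hBd
      (volume_snd_image_le hBc hB h0 h1 hBd)
    have hFpos : 0 < volume F := zero_le.trans_lt hFvol
    obtain ⟨f', a', hf', hcf'⟩ := ih F hFc hFpos hFd
    set q : (ℝ × (Fin n → ℝ)) ≃ₗ[ℝ] (ℝ × (Fin n → ℝ)) :=
      LinearEquiv.prodCongr (LinearEquiv.refl ℝ ℝ) f' with hq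
    set g2 := q.trans e.symm with hg2
    obtain ⟨κ₂, hκ₂0, hκ₂t, hκ₂⟩ := exists_volume_image_eq_mul g2
    have hg2c : Continuous g2 := g2.toContinuousLinearEquiv.continuous
    set B' := B ∩ univ ×ˢ F with hB'
    have hB'c : IsCompact B' := hBc.inter_right (isClosed_univ.prod hFc.isClosed)
    have hfib : ∀ (B : Set (ℝ × (Fin n → ℝ))) (F : Set (Fin n → ℝ)), MeasurableSet B →
        MeasurableSet F →
        (∀ h ∈ F, ENNReal.ofReal c1 ≤ volume ((fun t : ℝ => (t, h)) ⁻¹' B)) →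
        ENNReal.ofReal c1 * volume F ≤ volume B := by
      intro B F hB hF h
      calc ENNReal.ofReal c1 * volume F = ∫⁻ _ in F, ENNReal.ofReal c1 := by
            rw [setLIntegral_const]
        _ ≤ ∫⁻ h in F, volume ((fun t : ℝ => (t, h)) ⁻¹' B) := setLIntegral_mono' hF h
        _ ≤ ∫⁻ h, volume ((fun t : ℝ => (t, h)) ⁻¹' B) := setLIntegral_le_lintegral _ _
        _ = _ := by rw [Measure.volume_eq_prod, Measure.prod_apply_symm hB]
    have hB'vol : ENNReal.ofReal c1 * (4⁻¹ * volume B) ≤ volume B' := by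
      refine le_trans (by gcongr) (hfib B' F hB'c.measurableSet hFc.measurableSet fun h hh =>
        (hFB h hh).trans (measure_mono fun t ht => ⟨ht, trivial, hh⟩))
    have hqB' : ENNReal.ofReal c1 * ENNReal.ofReal c ≤ volume (q '' B') := by
      have hqc : Continuous q := q.toContinuousLinearEquiv.continuous
      have hf'c : Continuous f' := f'.toContinuousLinearEquiv.continuous
      refine le_trans (by gcongr) (hfib (q '' B') (f' '' F) (hB'c.image hqc).measurableSet
        (hFc.image hf'c).measurableSet ?_)
      rintro _ ⟨h, hh, rfl⟩
      exact (hFB h hh).trans (measure_mono fun t ht => ⟨(t, h), ⟨ht, trivial, hh⟩, rfl⟩)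
    set G := g2 '' B with hG
    set G' := g2 '' B' with hG'
    have hGc : IsCompact G := hBc.image hg2c
    have hGadd : G + G = g2 '' (B + B) := (image_add g2).symm
    have hGd : volume (G + G) < (2 ^ (n + 1) + 1) * volume G := by
      rw [hGadd, hG, hκ₂, hκ₂, mul_left_comm]
      exact ENNReal.mul_lt_mul_right hκ₂0 hκ₂t hBd
    have hGpos : 0 < volume G := by rw [hG, hκ₂]; positivity
    have hGf : volume G ≠ ⊤ := hGc.measure_lt_top.ne
    have hG'vol : κe * (ENNReal.ofReal c1 * ENNReal.ofReal c) ≤ volume G' := by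
      have : G' = e.symm '' (q '' B') := by rw [hG', hg2, image_image]; rfl
      rw [this, hκe]
      gcongr
    have hG'rel : ENNReal.ofReal (c1 / 4) * volume G ≤ volume G' := by
      rw [hG, hG', hκ₂, hκ₂, mul_left_comm]
      gcongr
      refine le_trans (le_of_eq ?_) hB'vol
      rw [← mul_assoc, div_eq_mul_inv, ENNReal.ofReal_mul hc10.le,
        ENNReal.ofReal_inv_of_pos (show (0 : ℝ) < 4 by norm_num), ENNReal.ofReal_ofNat]
    have hG'G : G' ⊆ G := image_mono inter_subset_left
    have hcoord : ∀ i, ∃ b, ∀ x ∈ G', x i ∈ Icc b (b + 2) := by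
      intro i
      refine Fin.cases ⟨0, ?_⟩ (fun j => ⟨a' j - 1, ?_⟩) i
      · rintro _ ⟨⟨t, h⟩, ⟨hB1, -⟩, rfl⟩
        have h5 := (hB hB1).1
        have h6 : g2 (t, h) 0 = t := by simp [hg2, he, hq, splitCoord]
        rw [h6]
        exact ⟨h5.1, h5.2.trans (by norm_num)⟩
      · rintro _ ⟨⟨t, h⟩, ⟨-, -, hF1⟩, rfl⟩
        have h6 : g2 (t, h) j.succ = f' h j := by
          simp [hg2, he, hq, splitCoord]
        rw [h6]
        have h7 := (norm_le_pi_norm (f' h - a') j).trans (hf' h hF1)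
        rw [Pi.sub_apply, Real.norm_eq_abs, abs_le] at h7
        constructor <;> linarith [h7.1, h7.2]
    have hwidth : ∀ i, ∀ x ∈ G, ∀ y ∈ G, x i - y i ≤ W := by
      intro i x hx y hy
      obtain ⟨b, hb⟩ := hcoord i
      have h5 := width_mul_volume_le hGc hGpos hGd hG'G i hb hx hy
      have h6 : ENNReal.ofReal (x i - y i) * (ENNReal.ofReal (c1 / 4) * volume G) ≤
          4 * (ENNReal.ofReal K * volume G) := by
        refine le_trans (by gcongr) (h5.trans ?_)
        gcongr
        rw [← hKe]; exact hGd.le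
      rw [← mul_assoc, ← mul_assoc, ENNReal.mul_le_mul_iff_left hGpos.ne' hGf,
        ← ENNReal.ofReal_mul' (by positivity), ← ENNReal.ofReal_ofNat,
        ← ENNReal.ofReal_mul (by norm_num), ENNReal.ofReal_le_ofReal_iff (by positivity)] at h6
      rw [hW, le_div_iff₀ hc10]
      linarith
    -- rescale
    obtain ⟨z₀, hz₀⟩ : A.Nonempty := nonempty_of_measure_ne_zero hpos.ne'
    set T := (e.trans g).trans g2 with hT
    have hTG : ∀ z ∈ A, T z - g2 (g p) ∈ G := fun z hz =>
      ⟨g (e z - p), ⟨e z, ⟨z, hz, rfl⟩, rfl⟩, by simp [hT]⟩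
    refine ⟨T.trans (LinearEquiv.smulOfNeZero ℝ _ W⁻¹ (inv_ne_zero hW0.ne')), W⁻¹ • T z₀,
      fun z hz => ?_, ?_⟩
    · have h5 : ‖T z - T z₀‖ ≤ W := by
        refine (pi_norm_le_iff_of_nonneg hW0.le).2 fun i => ?_
        have h6 := hwidth i _ (hTG z hz) _ (hTG z₀ hz₀)
        have h7 := hwidth i _ (hTG z₀ hz₀) _ (hTG z hz)
        simp only [Pi.sub_apply] at h6 h7
        rw [Real.norm_eq_abs, abs_le, Pi.sub_apply]
        constructor <;> linarith
      change ‖W⁻¹ • T z - W⁻¹ • T z₀‖ ≤ 1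
      rw [← smul_sub, norm_smul, norm_inv, Real.norm_of_nonneg hW0.le, inv_mul_le_iff₀ hW0]
      simpa using h5
    · have h5 : (T.trans (LinearEquiv.smulOfNeZero ℝ _ W⁻¹ (inv_ne_zero hW0.ne'))) '' A =
          W⁻¹ • (T '' A) := by
        rw [← image_smul, image_image]; rfl
      have h6 : volume G ≤ volume (T '' A) := by
        calc volume G = volume ((fun x => x + -(g2 (g p))) '' (T '' A)) := by
              congr 1
              rw [hG, hBdef, image_image, image_image, image_image]
              simp [hT, sub_eq_add_neg]
          _ = _ := by rw [image_add_right, measure_preimage_add_right]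
          _ ≤ _ := le_rfl
      rw [h5, Measure.addHaar_smul, hγ, Module.finrank_fin_fun, abs_of_pos (by positivity)]
      gcongr
      exact hG'vol.trans ((measure_mono hG'G).trans h6)

theorem volume_splitCoord_image {n : ℕ} (i : Fin (n + 1)) (S : Set (Fin (n + 1) → ℝ)) :
    volume (splitCoord i '' S) = volume S := by
  have h := volume_preserving_piFinSuccAbove (fun _ : Fin (n + 1) => ℝ) i
  have h2 := (h.symm _).measure_preimage_equiv S
  rw [← h2]
  congr 1
  exact (MeasurableEquiv.piFinSuccAbove (fun _ : Fin (n + 1) => ℝ) i).toEquiv.image_eq_preimage_symm S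

theorem two_mul_add_diff_translate_le_prod {n : ℕ} {A : Set (ℝ × (Fin n → ℝ))}
    (hA : IsCompact A) {s : ℝ} (hs : 0 ≤ s) :
    2 ^ n * (2 * volume A + volume (A \ (A + {(s, 0)}))) ≤
      volume (A + A) + 2 ^ n * (ENNReal.ofReal s * volume (Prod.snd '' A)) := by
  have hAA := hA.add hA
  have hAm := hA.measurableSet
  have hS : MeasurableSet (Prod.snd '' A) := (hA.image continuous_snd).measurableSet
  have hD : MeasurableSet (A \ (A + {(s, 0)})) :=
    hAm.diff (hA.add isCompact_singleton).measurableSet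
  have h1 : volume (A + A) = 2 ^ n * ∫⁻ h, volume ((fun t : ℝ => (t, (2 : ℝ) • h)) ⁻¹' (A + A)) := by
    rw [← lintegral_comp_const_smul, Measure.volume_eq_prod,
      Measure.prod_apply_symm hAA.measurableSet]
    simp [smul_smul]
  have h2 : ENNReal.ofReal s * volume (Prod.snd '' A) =
      ∫⁻ h, (Prod.snd '' A).indicator (fun _ => ENNReal.ofReal s) h := by
    rw [lintegral_indicator hS, setLIntegral_const]
  rw [h1, h2, ← mul_add, ← lintegral_add_right _ (measurable_const.indicator hS)]
  gcongr
  rw [Measure.volume_eq_prod, Measure.prod_apply_symm hAm, Measure.prod_apply_symm hD,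
    ← lintegral_const_mul _ (measurable_measure_prodMk_right hAm),
    ← lintegral_add_right _ (measurable_measure_prodMk_right hD)]
  refine lintegral_mono fun h => ?_
  by_cases hh : h ∈ Prod.snd '' A
  · rw [indicator_of_mem hh]
    obtain ⟨⟨t, _⟩, ht, rfl⟩ := hh
    refine le_trans ?_ ((two_mul_add_diff_translate_le (isCompact_fiber hA _) ⟨t, ht⟩ hs).trans ?_)
    · gcongr
      rintro u ⟨hu, hu'⟩
      refine ⟨hu, fun hc => hu' ?_⟩
      obtain ⟨v, hv, _, rfl, rfl⟩ := hc
      exact ⟨_, hv, _, rfl, by simp⟩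
    · gcongr
      rintro _ ⟨u, hu, v, hv, rfl⟩
      exact ⟨_, hu, _, hv, by simp [two_smul]⟩
  · have he : (fun t : ℝ => (t, h)) ⁻¹' A = ∅ := by
      ext t; simp only [mem_preimage, mem_empty_iff_false, iff_false]
      exact fun ht => hh ⟨_, ht, rfl⟩
    have he' : (fun t : ℝ => (t, h)) ⁻¹' (A \ (A + {(s, 0)})) = ∅ := by
      rw [preimage_sdiff, he, empty_sdiff]
    rw [he, he']
    simp

theorem volume_diff_translate_coord_le {n : ℕ} {A : Set (Fin (n + 1) → ℝ)} (hA : IsCompact A)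
    {a : Fin (n + 1) → ℝ} (ha : A ⊆ Metric.closedBall a 1) {δ : ℝ} (hδ : 0 ≤ δ)
    (hd : volume (A + A) ≤ ENNReal.ofReal (2 ^ (n + 1) + δ) * volume A)
    (i : Fin (n + 1)) {s : ℝ} (hs : 0 ≤ s) :
    volume (A \ (A + {Pi.single i s})) ≤ ENNReal.ofReal (δ * 2 ^ (n + 1) + s * 4 ^ n) := by
  have hec : Continuous (splitCoord (n := n) i) :=
    (splitCoord i).toContinuousLinearEquiv.continuous
  have h := two_mul_add_diff_translate_le_prod (hA.image hec) hs
  have hsing : splitCoord i (Pi.single i s) = (s, 0) := by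
    ext1
    · exact Pi.single_eq_same (M := fun _ => ℝ) i s
    · ext j
      exact Pi.single_eq_of_ne (M := fun _ => ℝ) (Fin.succAbove_ne i j) s
  have hAs : splitCoord i '' A + {(s, 0)} = splitCoord i '' (A + {Pi.single i s}) := by
    rw [image_add, image_singleton, hsing]
  rw [hAs, ← image_sdiff (splitCoord i).injective, ← image_add, volume_splitCoord_image,
    volume_splitCoord_image, volume_splitCoord_image] at h
  have hsnd : volume (Prod.snd '' (splitCoord i '' A)) ≤ 2 ^ n := by
    calc _ ≤ volume (Metric.closedBall (i.removeNth a) (1 : ℝ)) := by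
          apply measure_mono
          rintro _ ⟨_, ⟨x, hx, rfl⟩, rfl⟩
          rw [mem_closedBall_iff_norm]
          refine (pi_norm_le_iff_of_nonneg zero_le_one).2 fun j => ?_
          exact (norm_le_pi_norm (x - a) (i.succAbove j)).trans (mem_closedBall_iff_norm.1 (ha hx))
      _ = _ := by rw [Real.volume_pi_closedBall _ zero_le_one]; simp
  have hAf : volume A ≠ ⊤ := hA.measure_lt_top.ne
  have hA2 : volume A ≤ ENNReal.ofReal (2 ^ (n + 1)) := by
    calc _ ≤ volume (Metric.closedBall a (1 : ℝ)) := measure_mono ha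
      _ = _ := by rw [Real.volume_pi_closedBall _ zero_le_one]; simp
  set D := volume (A \ (A + {Pi.single i s}))
  have hδA : ENNReal.ofReal (2 ^ (n + 1) + δ) * volume A =
      2 ^ n * (2 * volume A) + ENNReal.ofReal δ * volume A := by
    rw [ENNReal.ofReal_add (by positivity) hδ, ENNReal.ofReal_pow (by norm_num)]
    simp; ring
  have h3 : 2 ^ n * (2 * volume A) + 2 ^ n * D ≤ 2 ^ n * (2 * volume A) +
      (ENNReal.ofReal δ * volume A + 2 ^ n * (ENNReal.ofReal s * 2 ^ n)) := by
    calc _ = _ := (mul_add _ _ _).symm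
      _ ≤ _ := h
      _ ≤ ENNReal.ofReal (2 ^ (n + 1) + δ) * volume A + 2 ^ n * (ENNReal.ofReal s * 2 ^ n) := by
          gcongr
      _ = _ := by rw [hδA]; ring
  rw [ENNReal.add_le_add_iff_left (by finiteness)] at h3
  calc D ≤ 2 ^ n * D := le_mul_of_one_le_left' (one_le_pow₀ one_le_two)
    _ ≤ _ := h3
    _ ≤ ENNReal.ofReal δ * ENNReal.ofReal (2 ^ (n + 1)) + 2 ^ n * (ENNReal.ofReal s * 2 ^ n) := by
        gcongr
    _ = _ := by
        rw [← ENNReal.ofReal_mul hδ, ENNReal.ofReal_add (by positivity) (by positivity),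
          ENNReal.ofReal_mul hs, ENNReal.ofReal_pow (by norm_num), mul_left_comm, ← mul_pow]
        norm_num

theorem volume_diff_translate_le {n : ℕ} {A : Set (Fin (n + 1) → ℝ)} (hA : IsCompact A)
    {a : Fin (n + 1) → ℝ} (ha : A ⊆ Metric.closedBall a 1) {δ : ℝ} (hδ : 0 ≤ δ)
    (hd : volume (A + A) ≤ ENNReal.ofReal (2 ^ (n + 1) + δ) * volume A)
    {ρ : ℝ} {h : Fin (n + 1) → ℝ} (hh : h ∈ Icc 0 (fun _ => ρ)) :
    volume (A \ (A + {h})) ≤ (n + 1) * ENNReal.ofReal (δ * 2 ^ (n + 1) + ρ * 4 ^ n) := by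
  set β := ENNReal.ofReal (δ * 2 ^ (n + 1) + ρ * 4 ^ n)
  have key : ∀ s : Finset (Fin (n + 1)),
      volume (A \ (A + {∑ i ∈ s, Pi.single i (h i)})) ≤ s.card * β := by
    intro s
    induction s using Finset.induction_on with
    | empty => simp
    | insert i s hi ih =>
      rw [Finset.sum_insert hi, Finset.card_insert_of_notMem hi]
      set u : Fin (n + 1) → ℝ := Pi.single i (h i)
      set v : Fin (n + 1) → ℝ := ∑ i ∈ s, Pi.single i (h i)
      have hsub : A \ (A + {u + v}) ⊆ (A \ (A + {v})) ∪ (fun x => x + -v) ⁻¹' (A \ (A + {u})) := by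
        rintro x ⟨hx, hx'⟩
        by_cases hv : x ∈ A + {v}
        · obtain ⟨y, hy, _, rfl, rfl⟩ := hv
          refine Or.inr ⟨by simpa using hy, fun hyu => hx' ?_⟩
          obtain ⟨z, hz, _, rfl, hzy⟩ := hyu
          refine ⟨z, hz, _, rfl, ?_⟩
          simp only [add_neg_cancel_right] at hzy
          simp only [← hzy, add_assoc]
        · exact Or.inl ⟨hx, hv⟩
      calc _ ≤ _ := measure_mono hsub
        _ ≤ _ := measure_union_le _ _
        _ = volume (A \ (A + {v})) + volume (A \ (A + {u})) := by rw [measure_preimage_add_right]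
        _ ≤ s.card * β + β := by
            gcongr
            refine (volume_diff_translate_coord_le hA ha hδ hd i (hh.1 i)).trans ?_
            refine ENNReal.ofReal_le_ofReal ?_
            gcongr
            exact hh.2 i
        _ = _ := by push_cast; ring
  have := key Finset.univ
  rw [Finset.univ_sum_single, Finset.card_univ, Fintype.card_fin] at this
  exact_mod_cast this

theorem exists_cube_subset_midpoints {n : ℕ} {c : ℝ} (hc : 0 < c) :
    ∃ ρ δ₀ : ℝ, 0 < ρ ∧ ρ ≤ 1 ∧ 0 < δ₀ ∧ ∀ A : Set (Fin (n + 1) → ℝ), IsCompact A →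
      ∀ a, A ⊆ Metric.closedBall a 1 → ENNReal.ofReal c ≤ volume A →
      ∀ δ, 0 ≤ δ → δ ≤ δ₀ → volume (A + A) ≤ ENNReal.ofReal (2 ^ (n + 1) + δ) * volume A →
      ∃ x ∈ A, ∀ z ∈ Metric.closedBall (x - fun _ => ρ / 2) (ρ / 4), z + z ∈ A + A := by
  set τ : ℝ := (2 ^ (n + 3))⁻¹ with hτ
  have hτ0 : 0 < τ := by positivity
  set ε : ℝ := τ * c / (2 * (n + 1)) with hε
  have hε0 : 0 < ε := by positivity
  set ρ : ℝ := min 1 (ε / (2 * 4 ^ n)) with hρ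
  have hρ0 : 0 < ρ := by positivity
  set δ₀ : ℝ := ε / (2 * 2 ^ (n + 1)) with hδ₀
  refine ⟨ρ, δ₀, hρ0, min_le_left _ _, by positivity, fun A hA a ha hcA δ hδ hδ' hd => ?_⟩
  have hbnd : δ * 2 ^ (n + 1) + ρ * 4 ^ n ≤ ε := by
    have e1 : δ * 2 ^ (n + 1) ≤ ε / 2 := by
      calc _ ≤ δ₀ * 2 ^ (n + 1) := by gcongr
        _ = _ := by rw [hδ₀]; field_simp
    have e2 : ρ * 4 ^ n ≤ ε / 2 := by
      calc _ ≤ ε / (2 * 4 ^ n) * 4 ^ n := by gcongr; exact min_le_right _ _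
        _ = _ := by field_simp
    linarith
  set Q : Set (Fin (n + 1) → ℝ) := Icc 0 (fun _ => ρ) with hQ
  have hQm : MeasurableSet Q := measurableSet_Icc
  have hQvol : volume Q = ENNReal.ofReal (ρ ^ (n + 1)) := by
    rw [hQ, Real.volume_Icc_pi]
    simp [ENNReal.ofReal_pow hρ0.le]
  have hAm := hA.measurableSet
  set S : Set ((Fin (n + 1) → ℝ) × (Fin (n + 1) → ℝ)) :=
    {z | z.1 ∈ A ∧ z.2 ∈ Q ∧ z.1 - z.2 ∉ A} with hS
  have hSm : MeasurableSet S := by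
    refine (measurable_fst hAm).inter ((measurable_snd hQm).inter ?_)
    exact (show Measurable fun z : (Fin (n + 1) → ℝ) × (Fin (n + 1) → ℝ) => z.1 - z.2 by
      fun_prop) hAm.compl
  have hupper : (volume.prod volume) S ≤ ENNReal.ofReal (ρ ^ (n + 1)) * ENNReal.ofReal (τ * c / 2) := by
    rw [Measure.prod_apply_symm hSm]
    calc ∫⁻ h, volume ((fun x => (x, h)) ⁻¹' S) ≤ ∫⁻ h, Q.indicator
          (fun _ => ENNReal.ofReal (τ * c / 2)) h := by
          refine lintegral_mono fun h => ?_
          by_cases hh : h ∈ Q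
          · rw [indicator_of_mem hh]
            calc _ ≤ volume (A \ (A + {h})) := by
                  refine measure_mono ?_
                  rintro x ⟨hx, -, hx'⟩
                  refine ⟨hx, ?_⟩
                  rintro ⟨y, hy, _, rfl, rfl⟩
                  exact hx' (by simpa using hy)
              _ ≤ _ := volume_diff_translate_le hA ha hδ hd hh
              _ ≤ (n + 1) * ENNReal.ofReal ε := by gcongr
              _ = ENNReal.ofReal ((n + 1) * ε) := by
                  rw [ENNReal.ofReal_mul (by positivity)]
                  congr 1
                  rw [ENNReal.ofReal_add (by positivity) (by norm_num)]
                  simp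
              _ = _ := by
                  congr 1
                  rw [hε]; field_simp
          · have : (fun x => (x, h)) ⁻¹' S = ∅ := by
              ext x
              simp only [mem_preimage, mem_empty_iff_false, iff_false]
              exact fun hx => hh hx.2.1
            rw [this]; simp
      _ = _ := by rw [lintegral_indicator hQm, setLIntegral_const, hQvol, mul_comm]
  obtain ⟨x, hx, hxN⟩ : ∃ x ∈ A,
      volume {h | h ∈ Q ∧ x - h ∉ A} ≤ ENNReal.ofReal (τ * ρ ^ (n + 1)) := by
    by_contra! hcon
    have hlower : ENNReal.ofReal (τ * ρ ^ (n + 1)) * ENNReal.ofReal c ≤ (volume.prod volume) S := by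
      rw [Measure.prod_apply hSm]
      calc _ ≤ ENNReal.ofReal (τ * ρ ^ (n + 1)) * volume A := by gcongr
        _ = ∫⁻ _ in A, ENNReal.ofReal (τ * ρ ^ (n + 1)) := by rw [setLIntegral_const]
        _ ≤ ∫⁻ x in A, volume (Prod.mk x ⁻¹' S) := by
            refine setLIntegral_mono' hAm fun x hx => (hcon x hx).le.trans (measure_mono ?_)
            exact fun h hh => ⟨hx, hh⟩
        _ ≤ _ := setLIntegral_le_lintegral _ _
    have := hlower.trans hupper
    rw [← ENNReal.ofReal_mul (by positivity), ← ENNReal.ofReal_mul (by positivity),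
      ENNReal.ofReal_le_ofReal_iff (by positivity)] at this
    have hp : 0 < ρ ^ (n + 1) * (τ * c) := by positivity
    linarith
  refine ⟨x, hx, fun z hz => ?_⟩
  set N := {h | h ∈ Q ∧ x - h ∉ A} with hN
  set w := x - z with hw
  set P := Metric.closedBall w (ρ / 4) with hP
  have hPQ : P ⊆ Q := by
    intro h hh
    rw [hP, mem_closedBall_iff_norm, pi_norm_le_iff_of_nonneg (by positivity)] at hh
    rw [mem_closedBall_iff_norm, pi_norm_le_iff_of_nonneg (by positivity)] at hz
    refine ⟨fun i => ?_, fun i => ?_⟩ <;>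
    · have h1 := hh i
      have h2 := hz i
      simp only [Pi.sub_apply, Real.norm_eq_abs, abs_le, hw, Pi.zero_apply] at h1 h2 ⊢
      linarith [h1.1, h1.2, h2.1, h2.2]
  have hPs : ∀ h ∈ P, w + w - h ∈ P := by
    intro h hh
    rw [hP, mem_closedBall_iff_norm] at hh ⊢
    have hneg : w + w - h - w = -(h - w) := by abel
    rwa [hneg, norm_neg]
  by_contra hcon
  have hcov : P ⊆ N ∪ (fun h => w + w - h) ⁻¹' N := by
    intro h hh
    by_cases h1 : x - h ∈ A
    · refine Or.inr ⟨hPQ (hPs h hh), fun h2 => hcon ⟨_, h1, _, h2, ?_⟩⟩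
      simp only [hw]; abel
    · exact Or.inl ⟨hPQ hh, h1⟩
  have hPvol : volume P ≤ ENNReal.ofReal (2 * (τ * ρ ^ (n + 1))) := by
    calc _ ≤ _ := measure_mono hcov
      _ ≤ _ := measure_union_le _ _
      _ = volume N + volume N := by
          rw [(Measure.measurePreserving_sub_left volume (w + w)).measure_preimage]
          exact (hQm.inter ((show Measurable fun h => x - h by fun_prop) hAm.compl)).nullMeasurableSet
      _ ≤ _ := by
          rw [two_mul, ENNReal.ofReal_add (by positivity) (by positivity)]
          gcongr
  rw [hP, Real.volume_pi_closedBall _ (by positivity), Fintype.card_fin,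
    ENNReal.ofReal_le_ofReal_iff (by positivity), hτ] at hPvol
  have e1 : (2 * (ρ / 4)) ^ (n + 1) = ρ ^ (n + 1) / 2 ^ (n + 1) := by
    rw [← div_pow]; congr 1; ring
  have e2 : 2 * ((2 ^ (n + 3))⁻¹ * ρ ^ (n + 1)) = ρ ^ (n + 1) / 2 ^ (n + 1) / 2 := by
    field_simp; ring
  rw [e1, e2] at hPvol
  have : 0 < ρ ^ (n + 1) / 2 ^ (n + 1) := by positivity
  linarith

/-- The sum of the letters of a word, where `none` stands for the variable `y`. -/
def wordSum {V : Type*} [AddCommMonoid V] (y : V) (l : List (Option V)) : V :=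
  (l.map fun o => o.getD y).sum

theorem wordSum_append {V : Type*} [AddCommMonoid V] (y : V) (l₁ l₂ : List (Option V)) :
    wordSum y (l₁ ++ l₂) = wordSum y l₁ + wordSum y l₂ := by
  simp [wordSum]

/-- Adjacent letters of a word may differ only if one of them is the variable. -/
def AdjacentLetters {V : Type*} (a b : Option V) : Prop := a = b ∨ a = none ∨ b = none

theorem exists_eq_replicate_of_isChain {V : Type*} {l : List (Option V)}
    (hl : l.IsChain AdjacentLetters) (h0 : l ≠ []) (hn : none ∉ l) :
    ∃ v, l = List.replicate l.length (some v) := by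
  induction l with
  | nil => exact absurd rfl h0
  | cons a t ih =>
    obtain _ | v := a
    · simp at hn
    refine ⟨v, ?_⟩
    cases t with
    | nil => simp
    | cons b t =>
      rw [List.isChain_cons_cons] at hl
      obtain ⟨w, hw⟩ := ih hl.2 (by simp) (fun h => hn (List.mem_cons_of_mem _ h))
      have hb : b = some v := by
        rcases hl.1 with h | h | h
        · exact h.symm
        · simp at h
        · exact absurd (by simp [h]) hn
      have hbw : b = some w := by
        have : b ∈ b :: t := by simp
        rw [hw] at this
        exact (List.mem_replicate.1 this).2
      rw [hb] at hbw
      rw [hw, hbw]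
      simp [List.replicate_succ]

theorem wordAverage_mem {V : Type*} [AddCommGroup V] [Module ℝ V] {A E : Set V}
    (hmid : ∀ a ∈ A, ∀ b ∈ A, (2⁻¹ : ℝ) • (a + b) ∈ A ∪ E) {y : V} (hy : y ∈ A) (j : ℕ)
    (l : List (Option V)) (hlen : l.length = 2 ^ j) (hl : l.IsChain AdjacentLetters)
    (hA : ∀ v, some v ∈ l → v ∈ A)
    (hE : ∀ l', l' <:+: l → none ∈ l' → (l'.length : ℝ)⁻¹ • wordSum y l' ∉ E) :
    (l.length : ℝ)⁻¹ • wordSum y l ∈ A := by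
  induction j generalizing l with
  | zero =>
    obtain ⟨a, rfl⟩ := List.length_eq_one_iff.1 (by simpa using hlen)
    cases a with
    | none => simpa [wordSum] using hy
    | some v => simpa [wordSum] using hA v (by simp)
  | succ j ih =>
    by_cases hn : none ∈ l
    · have h1 : (l.take (2 ^ j)).length = 2 ^ j := by
        rw [List.length_take, hlen, pow_succ]; omega
      have h2 : (l.drop (2 ^ j)).length = 2 ^ j := by
        rw [List.length_drop, hlen, pow_succ]; omega
      have hsplit := List.take_append_drop (2 ^ j) l
      have hi1 : l.take (2 ^ j) <:+: l := (List.take_prefix _ _).isInfix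
      have hi2 : l.drop (2 ^ j) <:+: l := (List.drop_suffix _ _).isInfix
      have m1 := ih _ h1 (hl.infix hi1) (fun v hv => hA v (hi1.subset hv))
        (fun l' hl' => hE l' (hl'.trans hi1))
      have m2 := ih _ h2 (hl.infix hi2) (fun v hv => hA v (hi2.subset hv))
        (fun l' hl' => hE l' (hl'.trans hi2))
      have h := hmid _ m1 _ m2
      have heq : (2⁻¹ : ℝ) • (((l.take (2 ^ j)).length : ℝ)⁻¹ • wordSum y (l.take (2 ^ j)) +
          ((l.drop (2 ^ j)).length : ℝ)⁻¹ • wordSum y (l.drop (2 ^ j))) =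
          (l.length : ℝ)⁻¹ • wordSum y l := by
        rw [h1, h2, ← smul_add, ← wordSum_append, hsplit, smul_smul, hlen]
        congr 1
        push_cast
        rw [pow_succ, mul_inv, mul_comm]
      rw [heq] at h
      exact h.resolve_right (hE l (List.infix_refl l) hn)
    · have hpos : 0 < l.length := by rw [hlen]; positivity
      obtain ⟨v, hv⟩ := exists_eq_replicate_of_isChain hl (List.length_pos_iff.1 hpos) hn
      have hvA : v ∈ A := hA v (by rw [hv]; exact List.mem_replicate.2 ⟨hpos.ne', rfl⟩)
      have : wordSum y l = (l.length : ℝ) • v := by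
        rw [hv]; simp [wordSum, List.map_replicate, List.sum_replicate, Nat.cast_smul_eq_nsmul]
      rw [this, smul_smul, inv_mul_cancel₀ (by positivity), one_smul]
      exact hvA

theorem exists_wordSum_eq {V : Type*} [AddCommGroup V] [Module ℝ V] (l : List (Option V)) :
    ∃ (c : ℕ) (b : V), (none ∈ l → 1 ≤ c) ∧ ∀ y, wordSum y l = (c : ℝ) • y + b := by
  induction l with
  | nil => exact ⟨0, 0, by simp, by simp [wordSum]⟩
  | cons a t ih =>
    obtain ⟨c, b, hc, h⟩ := ih
    cases a with
    | none =>
      refine ⟨c + 1, b, by simp, fun y => ?_⟩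
      have : wordSum y (none :: t) = y + wordSum y t := by simp [wordSum]
      rw [this, h]
      push_cast
      module
    | some v =>
      refine ⟨c, v + b, by simpa using hc, fun y => ?_⟩
      have : wordSum y (some v :: t) = v + wordSum y t := by simp [wordSum]
      rw [this, h]
      abel

/-- The word consisting of blocks of constant letters, separated by variables. -/
def blockWord {V : Type*} (L : List (ℕ × V)) (t : ℕ) : List (Option V) :=
  L.foldr (fun p acc => List.replicate p.1 (some p.2) ++ none :: acc) (List.replicate t none)

theorem isChain_blockWord {V : Type*} (L : List (ℕ × V)) (t : ℕ) :
    (blockWord L t).IsChain AdjacentLetters := by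
  induction L with
  | nil => exact List.isChain_replicate_of_rel t (Or.inl rfl)
  | cons p L ih =>
    change List.IsChain _ (List.replicate p.1 (some p.2) ++ none :: blockWord L t)
    rw [List.isChain_append]
    refine ⟨List.isChain_replicate_of_rel _ (Or.inl rfl), ?_, ?_⟩
    · rw [List.isChain_cons]
      exact ⟨fun _ _ => Or.inr (Or.inl rfl), ih⟩
    · intro x _ z hz
      simp only [List.head?_cons, Option.mem_some_iff] at hz
      exact Or.inr (Or.inr hz.symm)

theorem length_blockWord {V : Type*} (L : List (ℕ × V)) (t : ℕ) :
    (blockWord L t).length = (L.map Prod.fst).sum + L.length + t := by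
  induction L with
  | nil => simp [blockWord]
  | cons p L ih =>
    change (List.replicate p.1 (some p.2) ++ none :: blockWord L t).length = _
    simp [ih]
    omega

theorem wordSum_blockWord {V : Type*} [AddCommGroup V] [Module ℝ V] (L : List (ℕ × V)) (t : ℕ)
    (y : V) : wordSum y (blockWord L t) =
      (L.map fun p => (p.1 : ℝ) • p.2).sum + ((L.length + t : ℕ) : ℝ) • y := by
  induction L with
  | nil => simp [blockWord, wordSum, Nat.cast_smul_eq_nsmul]
  | cons p L ih =>
    change wordSum y (List.replicate p.1 (some p.2) ++ none :: blockWord L t) = _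
    have h : wordSum y (none :: blockWord L t) = y + wordSum y (blockWord L t) := by
      simp [wordSum]
    have h' : wordSum y (List.replicate p.1 (some p.2)) = (p.1 : ℝ) • p.2 := by
      simp [wordSum, List.map_replicate, List.sum_replicate, Nat.cast_smul_eq_nsmul]
    rw [wordSum_append, h, ih, h', List.map_cons, List.sum_cons, List.length_cons]
    push_cast
    module

theorem mem_of_mem_blockWord {V : Type*} (L : List (ℕ × V)) (t : ℕ) {v : V}
    (hv : some v ∈ blockWord L t) : ∃ p ∈ L, p.2 = v := by
  induction L with
  | nil => simp [blockWord] at hv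
  | cons p L ih =>
    change some v ∈ List.replicate p.1 (some p.2) ++ none :: blockWord L t at hv
    simp only [List.mem_append, List.mem_replicate, List.mem_cons] at hv
    rcases hv with ⟨-, h⟩ | h | h
    · exact ⟨p, by simp, (Option.some.inj h).symm⟩
    · simp at h
    · obtain ⟨q, hq, h⟩ := ih h
      exact ⟨q, List.mem_cons_of_mem _ hq, h⟩

/-- A dyadic average map contracts towards points of `A`, and misses `A` only on the image of
the complement of `A`, up to a multiple of the set of bad midpoints. -/
theorem volume_cell_diff_le {k : ℕ} {A E : Set (Fin k → ℝ)}
    (hmid : ∀ a ∈ A, ∀ b ∈ A, (2⁻¹ : ℝ) • (a + b) ∈ A ∪ E) {v : Fin k → Fin k → ℝ}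
    (hv : ∀ i, v i ∈ A) {n : Fin k → ℕ} {m j : ℕ} (hkm : k ≤ m) (hm : 1 ≤ m)
    (hN : ∑ i, n i + m = 2 ^ j) (Y : Set (Fin k → ℝ)) :
    volume ((fun y => ((2 : ℝ) ^ j)⁻¹ • (∑ i, (n i : ℝ) • v i + (m : ℝ) • y)) '' Y \ A) ≤
      ENNReal.ofReal ((m / 2 ^ j) ^ k) * volume (Y \ A) +
        ENNReal.ofReal ((2 ^ j + 1) ^ 2 * (2 ^ j) ^ k) * volume E := by
  set T : (Fin k → ℝ) → Fin k → ℝ :=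
    fun y => ((2 : ℝ) ^ j)⁻¹ • (∑ i, (n i : ℝ) • v i + (m : ℝ) • y) with hT
  set w := blockWord (List.ofFn fun i => (n i, v i)) (m - k) with hw
  have hlen : w.length = 2 ^ j := by
    rw [hw, length_blockWord, List.map_ofFn, List.sum_ofFn, List.length_ofFn, ← hN]
    simp only [Function.comp_apply]
    omega
  have hsum : ∀ y, wordSum y w = ∑ i, (n i : ℝ) • v i + (m : ℝ) • y := by
    intro y
    rw [hw, wordSum_blockWord, List.map_ofFn, List.sum_ofFn, List.length_ofFn,
      Nat.add_sub_cancel' hkm]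
    rfl
  have hTw : ∀ y, (w.length : ℝ)⁻¹ • wordSum y w = T y := by
    intro y
    rw [hlen, hsum]
    push_cast
    rfl
  have hvol : ∀ S, volume (T '' S) = ENNReal.ofReal ((m / 2 ^ j) ^ k) * volume S := by
    intro S
    have : T '' S = {((2 : ℝ) ^ j)⁻¹ • ∑ i, (n i : ℝ) • v i} + ((m : ℝ) / 2 ^ j) • S := by
      rw [singleton_add, ← image_smul, image_image]
      refine image_congr fun y _ => ?_
      rw [hT]
      simp only [smul_add, smul_smul, div_eq_inv_mul]
    rw [this, singleton_add, image_add_left, measure_preimage_add, Measure.addHaar_smul,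
      Module.finrank_fin_fun, abs_of_nonneg (by positivity)]
  let I := Finset.range (2 ^ j + 1) ×ˢ Finset.range (2 ^ j + 1)
  let B : ℕ × ℕ → Set (Fin k → ℝ) := fun p =>
    {y | none ∈ (w.drop p.1).take p.2 ∧
      (((w.drop p.1).take p.2).length : ℝ)⁻¹ • wordSum y ((w.drop p.1).take p.2) ∈ E}
  have hB : ∀ p, volume (B p) ≤ ENNReal.ofReal ((2 ^ j) ^ k) * volume E := by
    intro p
    set l := (w.drop p.1).take p.2 with hl
    by_cases hn : none ∈ l
    · obtain ⟨c, b, hc, h⟩ := exists_wordSum_eq l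
      have hc := hc hn
      have hll : (0 : ℝ) < l.length := by
        have := List.length_pos_of_mem hn
        positivity
      have hll' : (l.length : ℝ) ≤ 2 ^ j := by
        have : l.length ≤ w.length := by
          rw [hl, List.length_take, List.length_drop]; omega
        rw [hlen] at this
        exact_mod_cast this
      have hc' : (1 : ℝ) ≤ c := by exact_mod_cast hc
      have hsub : B p ⊆ ((l.length : ℝ) / c) • ((fun x => (l.length : ℝ)⁻¹ • b + x) ⁻¹' E) := by
        rintro y ⟨-, hy⟩
        rw [mem_smul_set_iff_inv_smul_mem₀ (by positivity)]
        change _ ∈ E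
        convert hy using 1
        rw [← hl, h, smul_add, smul_smul, inv_div, add_comm, div_eq_inv_mul]
      refine (measure_mono hsub).trans ?_
      rw [Measure.addHaar_smul, measure_preimage_add, Module.finrank_fin_fun,
        abs_of_nonneg (by positivity)]
      gcongr
      exact (div_le_self hll.le hc').trans hll'
    · have : B p = ∅ := by
        ext y
        simp only [B, mem_ofPred_eq, mem_empty_iff_false, iff_false, ← hl]
        exact fun h => hn h.1
      rw [this]
      simp
  have hcov : T '' Y \ A ⊆ T '' (Y \ A) ∪ ⋃ p ∈ I, T '' B p := by
    rintro _ ⟨⟨y, hy, rfl⟩, hyA⟩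
    by_cases hy' : y ∈ A
    · by_contra hcon
      rw [mem_union, not_or] at hcon
      apply hyA
      rw [← hTw]
      refine wordAverage_mem hmid hy' j w hlen (isChain_blockWord _ _) ?_ ?_
      · intro u hu
        obtain ⟨p, hp, rfl⟩ := mem_of_mem_blockWord _ _ hu
        rw [List.mem_ofFn] at hp
        obtain ⟨i, rfl⟩ := hp
        exact hv i
      · intro l' hl' hn hE
        obtain ⟨s, t, hst⟩ := hl'
        apply hcon.2
        have hl : l' = (w.drop s.length).take l'.length := by
          rw [← hst]; simp
        have hle : s.length + l'.length + t.length = 2 ^ j := by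
          rw [← hlen, ← hst]; simp [add_assoc]
        rw [mem_iUnion₂]
        refine ⟨(s.length, l'.length), ?_, y, ⟨?_, ?_⟩, rfl⟩
        · simp only [I, Finset.mem_product, Finset.mem_range]
          omega
        · simpa only [← hl] using hn
        · simpa only [← hl] using hE
    · exact Or.inl ⟨y, ⟨hy, hy'⟩, rfl⟩
  have hratio : ENNReal.ofReal ((m / 2 ^ j) ^ k) ≤ 1 := by
    rw [ENNReal.ofReal_le_one]
    apply pow_le_one₀ (by positivity)
    rw [div_le_one (by positivity)]
    have : m ≤ 2 ^ j := by omega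
    exact_mod_cast this
  calc volume (T '' Y \ A) ≤ volume (T '' (Y \ A)) + volume (⋃ p ∈ I, T '' B p) :=
        (measure_mono hcov).trans (measure_union_le _ _)
    _ ≤ ENNReal.ofReal ((m / 2 ^ j) ^ k) * volume (Y \ A) +
        ∑ p ∈ I, ENNReal.ofReal ((2 ^ j) ^ k) * volume E := by
        rw [hvol]
        gcongr
        refine (measure_biUnion_finset_le _ _).trans (Finset.sum_le_sum fun p _ => ?_)
        rw [hvol]
        calc _ ≤ 1 * volume (B p) := by gcongr
          _ ≤ _ := by rw [one_mul]; exact hB p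
    _ = _ := by
        rw [Finset.sum_const, Finset.card_product, Finset.card_range, nsmul_eq_mul, ← mul_assoc,
          ENNReal.ofReal_mul (by positivity), ← sq]
        congr 3
        rw [ENNReal.ofReal_pow (by positivity)]
        push_cast
        congr 1
        rw [ENNReal.ofReal_add (by positivity) zero_le_one, ENNReal.ofReal_pow zero_le_two,
          ENNReal.ofReal_one, ENNReal.ofReal_ofNat]

theorem exists_rounding {k N : ℕ} (hkN : k ≤ N) {l : Fin k → ℝ} (h0 : ∀ i, 0 ≤ l i)
    (h1 : ∑ i, l i ≤ 1) : ∃ (n : Fin k → ℕ) (m : ℕ), k ≤ m ∧ ∑ i, n i + m = N ∧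
      ∀ i, (n i : ℝ) ≤ N * l i ∧ (n i : ℝ) ≤ (N - k) * l i ∧ N * l i - n i ≤ 1 + k * l i := by
  have hkN' : (0 : ℝ) ≤ N - k := sub_nonneg.2 (by exact_mod_cast hkN)
  have hfl : ∀ i, (⌊((N : ℝ) - k) * l i⌋₊ : ℝ) ≤ (N - k) * l i :=
    fun i => Nat.floor_le (mul_nonneg hkN' (h0 i))
  have hsum : ∑ i, ⌊((N : ℝ) - k) * l i⌋₊ + k ≤ N := by
    have : ((∑ i, ⌊((N : ℝ) - k) * l i⌋₊ + k : ℕ) : ℝ) ≤ N := by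
      push_cast
      have h2 := Finset.sum_le_sum fun i (_ : i ∈ Finset.univ) => hfl i
      rw [← Finset.mul_sum] at h2
      nlinarith
    exact_mod_cast this
  refine ⟨fun i => ⌊((N : ℝ) - k) * l i⌋₊, N - ∑ i, ⌊((N : ℝ) - k) * l i⌋₊, by omega,
    by dsimp only; omega,
    fun i => ⟨?_, hfl i, ?_⟩⟩
  · have h3 : (0 : ℝ) ≤ k * l i := mul_nonneg (Nat.cast_nonneg k) (h0 i)
    linarith [hfl i]
  · linarith [Nat.lt_floor_add_one (((N : ℝ) - k) * l i)]

/-- Points that are combinations of `k` points of `A` with coefficient sum at most `1 - η`. -/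
def contractedSpan {k : ℕ} (A : Set (Fin k → ℝ)) (η : ℝ) : Set (Fin k → ℝ) :=
  {x | ∃ (v : Fin k → Fin k → ℝ) (l : Fin k → ℝ), (∀ i, v i ∈ A) ∧ (∀ i, 0 ≤ l i) ∧
    ∑ i, l i ≤ 1 - η ∧ ∑ i, l i • v i = x}

theorem norm_sum_smul_le {k : ℕ} {v : Fin k → Fin k → ℝ} {R : ℝ} (hv : ∀ i, ‖v i‖ ≤ R)
    {l : Fin k → ℝ} (h0 : ∀ i, 0 ≤ l i) : ‖∑ i, l i • v i‖ ≤ (∑ i, l i) * R := by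
  rw [Finset.sum_mul]
  refine norm_sum_le_of_le _ fun i _ => ?_
  rw [norm_smul, Real.norm_of_nonneg (h0 i)]
  exact mul_le_mul_of_nonneg_left (hv i) (h0 i)

theorem exists_volume_contractedSpan_diff_le {k : ℕ} (hk : 1 ≤ k) {r R η : ℝ} (hr : 0 < r)
    (hR : 0 < R) (hη : 0 < η) (hη1 : η ≤ 1) :
    ∃ C : ℝ, 0 ≤ C ∧ ∀ A E : Set (Fin k → ℝ), A ⊆ Metric.closedBall 0 R →
      (∀ a ∈ A, ∀ b ∈ A, (2⁻¹ : ℝ) • (a + b) ∈ A ∪ E) →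
      volume (Metric.closedBall 0 r \ A) ≤ volume E →
      volume (contractedSpan A η \ A) ≤ ENNReal.ofReal C * volume E := by
  obtain ⟨j, hj⟩ := pow_unbounded_of_one_lt (k + 4 * k * R / (η * r)) (one_lt_two (α := ℝ))
  have hpos : 0 ≤ 4 * k * R / (η * r) := by positivity
  have hkN : k ≤ 2 ^ j := by
    have : (k : ℝ) ≤ 2 ^ j := by linarith
    exact_mod_cast this
  have hN : 4 * k * R ≤ 2 ^ j * (η * r) := by
    rw [← div_le_iff₀ (by positivity)]
    have : (0 : ℝ) ≤ k := by positivity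
    linarith
  obtain ⟨t, -, ht, hcov⟩ := (isCompact_closedBall (0 : Fin k → ℝ) R).finite_cover_balls
    (show 0 < η * r / 4 by positivity)
  refine ⟨ht.toFinset.card * (1 + (2 ^ j + 1) ^ 2 * (2 ^ j) ^ k), by positivity, ?_⟩
  intro A E hA hmid hball
  have hAn : ∀ v ∈ A, ‖v‖ ≤ R := fun v hv => by simpa using hA hv
  have hpiece : ∀ p, volume ((contractedSpan A η \ A) ∩ Metric.ball p (η * r / 4)) ≤
      ENNReal.ofReal (1 + (2 ^ j + 1) ^ 2 * (2 ^ j) ^ k) * volume E := by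
    intro p
    rcases (contractedSpan A η ∩ Metric.ball p (η * r / 4)).eq_empty_or_nonempty with h | h
    · have : (contractedSpan A η \ A) ∩ Metric.ball p (η * r / 4) = ∅ := by
        rw [← subset_empty_iff, ← h]
        exact inter_subset_inter_left _ sdiff_subset
      rw [this]
      simp
    obtain ⟨_, ⟨v, l, hv, hl0, hl1, rfl⟩, hx0⟩ := h
    obtain ⟨n, m, hkm, hnm, hn⟩ := exists_rounding hkN hl0 (by linarith)
    have hnm' : ∑ i, (n i : ℝ) + m = 2 ^ j := by exact_mod_cast hnm
    push_cast at hn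
    have hm0 : (0 : ℝ) < m := by
      have : 0 < m := by omega
      exact_mod_cast this
    have hmη : η * 2 ^ j ≤ m := by
      have h2 := Finset.sum_le_sum fun i (_ : i ∈ Finset.univ) => (hn i).2.1
      rw [← Finset.mul_sum] at h2
      have h3 : (0 : ℝ) ≤ 2 ^ j - k := sub_nonneg.2 (by exact_mod_cast hkN)
      have h4 : (0 : ℝ) ≤ k := by positivity
      nlinarith [mul_le_mul_of_nonneg_left hl1 h3, mul_nonneg h4 (sub_nonneg.2 hη1)]
    have hsub : (contractedSpan A η \ A) ∩ Metric.ball p (η * r / 4) ⊆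
        (fun y => ((2 : ℝ) ^ j)⁻¹ • (∑ i, (n i : ℝ) • v i + (m : ℝ) • y)) ''
          Metric.closedBall 0 r \ A := by
      rintro x ⟨⟨-, hxA⟩, hx⟩
      refine ⟨⟨(m : ℝ)⁻¹ • ((2 : ℝ) ^ j • x - ∑ i, (n i : ℝ) • v i), ?_, ?_⟩, hxA⟩
      · have hxx : ‖x - ∑ i, l i • v i‖ ≤ η * r / 2 := by
          rw [← dist_eq_norm]
          have := dist_triangle_right x (∑ i, l i • v i) p
          rw [Metric.mem_ball] at hx hx0
          linarith
        have heq : (2 : ℝ) ^ j • x - ∑ i, (n i : ℝ) • v i =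
            (2 : ℝ) ^ j • (x - ∑ i, l i • v i) + ∑ i, ((2 : ℝ) ^ j * l i - n i) • v i := by
          simp only [sub_smul, Finset.sum_sub_distrib, mul_smul, ← Finset.smul_sum, smul_sub]
          abel
        have hb : ‖∑ i, ((2 : ℝ) ^ j * l i - n i) • v i‖ ≤ 2 * k * R := by
          refine (norm_sum_smul_le (fun i => hAn _ (hv i))
            (fun i => sub_nonneg.2 (hn i).1)).trans ?_
          gcongr
          calc ∑ i, ((2 : ℝ) ^ j * l i - n i) ≤ ∑ i, (1 + k * l i) :=
                Finset.sum_le_sum fun i _ => (hn i).2.2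
            _ = k + k * ∑ i, l i := by
                rw [Finset.sum_add_distrib, ← Finset.mul_sum]; simp
            _ ≤ 2 * k := by
                have h4 : (0 : ℝ) ≤ k := by positivity
                nlinarith
        rw [mem_closedBall_zero_iff, norm_smul, norm_inv, Real.norm_of_nonneg hm0.le,
          inv_mul_le_iff₀ hm0, heq]
        calc _ ≤ (2 : ℝ) ^ j * (η * r / 2) + 2 * k * R := by
              refine (norm_add_le _ _).trans (add_le_add ?_ hb)
              rw [norm_smul, Real.norm_of_nonneg (by positivity)]
              gcongr
          _ ≤ η * 2 ^ j * r := by linarith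
          _ ≤ m * r := by gcongr
      · simp only
        rw [smul_inv_smul₀ hm0.ne', add_sub_cancel, inv_smul_smul₀ (by positivity)]
    calc _ ≤ _ := measure_mono hsub
      _ ≤ _ := volume_cell_diff_le hmid hv hkm (by omega) hnm _
      _ ≤ 1 * volume E + ENNReal.ofReal ((2 ^ j + 1) ^ 2 * (2 ^ j) ^ k) * volume E := by
          gcongr
          rw [ENNReal.ofReal_le_one]
          apply pow_le_one₀ (by positivity)
          rw [div_le_one (by positivity), ← hnm']
          have : 0 ≤ ∑ i, (n i : ℝ) := by positivity
          linarith
      _ = _ := by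
          rw [ENNReal.ofReal_add zero_le_one (by positivity), ENNReal.ofReal_one, add_mul]
  have hI : contractedSpan A η \ A ⊆
      ⋃ p ∈ ht.toFinset, (contractedSpan A η \ A) ∩ Metric.ball p (η * r / 4) := by
    intro x hx
    have hxR : x ∈ Metric.closedBall (0 : Fin k → ℝ) R := by
      obtain ⟨v, l, hv, hl0, hl1, rfl⟩ := hx.1
      rw [mem_closedBall_zero_iff]
      refine (norm_sum_smul_le (fun i => hAn _ (hv i)) hl0).trans ?_
      exact mul_le_of_le_one_left hR.le (by linarith)
    obtain ⟨p, hp, hxp⟩ := mem_iUnion₂.1 (hcov hxR)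
    exact mem_iUnion₂.2 ⟨p, ht.mem_toFinset.2 hp, hx, hxp⟩
  calc _ ≤ _ := measure_mono hI
    _ ≤ _ := measure_biUnion_finset_le _ _
    _ ≤ ∑ p ∈ ht.toFinset, ENNReal.ofReal (1 + (2 ^ j + 1) ^ 2 * (2 ^ j) ^ k) * volume E :=
        Finset.sum_le_sum fun p _ => hpiece p
    _ = _ := by
        rw [Finset.sum_const, nsmul_eq_mul, ← mul_assoc, ENNReal.ofReal_mul (by positivity),
          ENNReal.ofReal_natCast]

/-- The convex hull of the origin and the points `v i`. -/
def starSimplex {k : ℕ} (v : Fin k → Fin k → ℝ) : Set (Fin k → ℝ) :=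
  {x | ∃ l : Fin k → ℝ, (∀ i, 0 ≤ l i) ∧ ∑ i, l i ≤ 1 ∧ ∑ i, l i • v i = x}

theorem mem_starSimplex_self {k : ℕ} (v : Fin k → Fin k → ℝ) (i : Fin k) :
    v i ∈ starSimplex v := by
  classical
  refine ⟨Pi.single i 1, fun i' => ?_, by simp, by simp [Pi.single_apply]⟩
  rw [Pi.single_apply]
  split_ifs <;> norm_num

theorem midpoint_mem_starSimplex {k : ℕ} {v : Fin k → Fin k → ℝ} {a b : Fin k → ℝ}
    (ha : a ∈ starSimplex v) (hb : b ∈ starSimplex v) :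
    (2⁻¹ : ℝ) • (a + b) ∈ starSimplex v := by
  obtain ⟨l, hl0, hl1, rfl⟩ := ha
  obtain ⟨l', hl0', hl1', rfl⟩ := hb
  refine ⟨fun i => 2⁻¹ * (l i + l' i), fun i => ?_, ?_, ?_⟩
  · have := hl0 i
    have := hl0' i
    positivity
  · rw [← Finset.mul_sum, Finset.sum_add_distrib]
    linarith
  · simp only [mul_smul, add_smul, ← Finset.smul_sum, Finset.sum_add_distrib]

theorem volume_starSimplex_lt_top {k : ℕ} (v : Fin k → Fin k → ℝ) :
    volume (starSimplex v) < ⊤ := by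
  have hR : ∀ i, ‖v i‖ ≤ ∑ i, ‖v i‖ := fun i =>
    Finset.single_le_sum (f := fun i => ‖v i‖) (fun i _ => norm_nonneg _) (Finset.mem_univ i)
  refine (measure_mono (t := Metric.closedBall 0 (∑ i, ‖v i‖)) ?_).trans_lt
    measure_closedBall_lt_top
  rintro _ ⟨l, hl0, hl1, rfl⟩
  rw [mem_closedBall_zero_iff]
  refine (norm_sum_smul_le hR hl0).trans (mul_le_of_le_one_left ?_ hl1)
  positivity

/-- A simplex minus the contracted span of `A` is covered by few small cells. -/
theorem starSimplex_diff_contractedSpan_subset {d j : ℕ} (hj : d + 1 ≤ 2 ^ j)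
    {A : Set (Fin (d + 1) → ℝ)} {v : Fin (d + 1) → Fin (d + 1) → ℝ} (hv : ∀ i, v i ∈ A)
    {x : Fin (d + 1) → ℝ} (hx : x ∈ starSimplex v) (hxI : x ∉ contractedSpan A (2 ^ j)⁻¹) :
    ∃ (n : Fin (d + 1) → ℕ) (m : ℕ), d + 1 ≤ m ∧ m ≤ 2 * (d + 1) + 1 ∧ ∑ i, n i + m = 2 ^ j ∧
      x ∈ (fun y => ((2 : ℝ) ^ j)⁻¹ • (∑ i, (n i : ℝ) • v i + (m : ℝ) • y)) ''
        starSimplex v := by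
  obtain ⟨l, hl0, hl1, rfl⟩ := hx
  have hl2 : 1 - (2 ^ j)⁻¹ < ∑ i, l i := by
    by_contra h
    exact hxI ⟨v, l, hv, hl0, not_lt.1 h, rfl⟩
  obtain ⟨n, m, hkm, hnm, hn⟩ := exists_rounding hj hl0 hl1
  have hnm' : ∑ i, (n i : ℝ) + m = 2 ^ j := by exact_mod_cast hnm
  push_cast at hn
  have hm0 : (0 : ℝ) < m := by
    have : 0 < m := by omega
    exact_mod_cast this
  refine ⟨n, m, hkm, ?_, hnm, ∑ i, ((m : ℝ)⁻¹ * (2 ^ j * l i - n i)) • v i,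
    ⟨_, fun i => ?_, ?_, rfl⟩, ?_⟩
  · have h1 : ∑ i, (2 ^ j * l i - n i) ≤ ∑ i, (1 + ((d : ℝ) + 1) * l i) :=
      Finset.sum_le_sum fun i _ => (hn i).2.2
    rw [Finset.sum_sub_distrib, Finset.sum_add_distrib, ← Finset.mul_sum, ← Finset.mul_sum] at h1
    simp only [Finset.sum_const, Finset.card_univ, Fintype.card_fin, nsmul_eq_mul, mul_one] at h1
    push_cast at h1
    have h2 : 2 ^ j - 1 < 2 ^ j * ∑ i, l i := by
      have := mul_lt_mul_of_pos_left hl2 (show (0 : ℝ) < 2 ^ j by positivity)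
      rwa [mul_sub, mul_one, mul_inv_cancel₀ (by positivity)] at this
    have h3 : ((d : ℝ) + 1) * ∑ i, l i ≤ d + 1 := mul_le_of_le_one_right (by positivity) hl1
    have h4 : (m : ℝ) < (2 * (d + 1) + 1 + 1 : ℕ) := by
      push_cast
      linarith
    have h5 : m < 2 * (d + 1) + 1 + 1 := by exact_mod_cast h4
    omega
  · have := sub_nonneg.2 (hn i).1
    positivity
  · rw [← Finset.mul_sum, Finset.sum_sub_distrib, ← Finset.mul_sum, inv_mul_le_iff₀ hm0]
    have : 2 ^ j * ∑ i, l i ≤ 2 ^ j := mul_le_of_le_one_right (by positivity) hl1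
    linarith
  · simp only [mul_smul, sub_smul, ← Finset.smul_sum, Finset.sum_sub_distrib]
    rw [smul_inv_smul₀ hm0.ne', add_sub_cancel, inv_smul_smul₀ (by positivity)]

theorem volume_starSimplex_strip_le {d j : ℕ} (hj : d + 1 ≤ 2 ^ j)
    {A E : Set (Fin (d + 1) → ℝ)}
    (hmid : ∀ a ∈ A, ∀ b ∈ A, (2⁻¹ : ℝ) • (a + b) ∈ A ∪ E)
    {v : Fin (d + 1) → Fin (d + 1) → ℝ} (hv : ∀ i, v i ∈ A) :
    volume ((starSimplex v \ A) \ contractedSpan A (2 ^ j)⁻¹) ≤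
      ENNReal.ofReal ((2 * (d + 1) + 2) * (2 ^ j + 1) ^ d) *
        (ENNReal.ofReal (((2 * (d + 1) + 1) / 2 ^ j) ^ (d + 1)) * volume (starSimplex v \ A) +
          ENNReal.ofReal ((2 ^ j + 1) ^ 2 * (2 ^ j) ^ (d + 1)) * volume (E ∩ starSimplex v)) := by
  have hmid' : ∀ a ∈ A ∩ starSimplex v, ∀ b ∈ A ∩ starSimplex v,
      (2⁻¹ : ℝ) • (a + b) ∈ A ∩ starSimplex v ∪ E ∩ starSimplex v := by
    intro a ha b hb
    rw [← union_inter_distrib_right]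
    exact ⟨hmid a ha.1 b hb.1, midpoint_mem_starSimplex ha.2 hb.2⟩
  have hYA : starSimplex v \ (A ∩ starSimplex v) = starSimplex v \ A := by
    ext x; simp
  let φ : ℕ × (Fin d → Fin (2 ^ j + 1)) → Fin (d + 1) → ℕ := fun p =>
    Fin.cons (2 ^ j - p.1 - ∑ i, (p.2 i : ℕ)) (fun i => (p.2 i : ℕ))
  let T : ℕ × (Fin d → Fin (2 ^ j + 1)) → (Fin (d + 1) → ℝ) → Fin (d + 1) → ℝ := fun p y =>
    ((2 : ℝ) ^ j)⁻¹ • (∑ i, (φ p i : ℝ) • v i + (p.1 : ℝ) • y)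
  let I : Finset (ℕ × (Fin d → Fin (2 ^ j + 1))) :=
    Finset.range (2 * (d + 1) + 2) ×ˢ Finset.univ
  let J := I.filter fun p => d + 1 ≤ p.1 ∧ ∑ i, φ p i + p.1 = 2 ^ j
  have hcov : (starSimplex v \ A) \ contractedSpan A (2 ^ j)⁻¹ ⊆
      ⋃ p ∈ J, T p '' starSimplex v \ (A ∩ starSimplex v) := by
    rintro x ⟨⟨hx, hxA⟩, hxI⟩
    obtain ⟨n, m, hkm, hmk, hnm, h⟩ := starSimplex_diff_contractedSpan_subset hj hv hx hxI
    have hle : ∀ i, n i < 2 ^ j + 1 := by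
      intro i
      have := Finset.single_le_sum (f := n) (fun i _ => Nat.zero_le _) (Finset.mem_univ i)
      omega
    have hφ : φ (m, fun i => ⟨n i.succ, hle _⟩) = n := by
      ext i
      refine Fin.cases ?_ (fun i => ?_) i
      · simp only [φ, Fin.cons_zero]
        rw [Fin.sum_univ_succ] at hnm
        omega
      · simp only [φ, Fin.cons_succ]
    refine mem_iUnion₂.2 ⟨(m, fun i => ⟨n i.succ, hle _⟩), ?_, ?_, fun h => hxA h.1⟩
    · rw [Finset.mem_filter, Finset.mem_product, hφ]
      exact ⟨⟨Finset.mem_range.2 (by omega), Finset.mem_univ _⟩, hkm, hnm⟩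
    · simp only [T, hφ]
      exact h
  calc _ ≤ _ := measure_mono hcov
    _ ≤ _ := measure_biUnion_finset_le _ _
    _ ≤ ∑ p ∈ J, (ENNReal.ofReal (((2 * (d + 1) + 1) / 2 ^ j) ^ (d + 1)) *
          volume (starSimplex v \ A) +
          ENNReal.ofReal ((2 ^ j + 1) ^ 2 * (2 ^ j) ^ (d + 1)) * volume (E ∩ starSimplex v)) := by
        refine Finset.sum_le_sum fun p hp => ?_
        rw [Finset.mem_filter, Finset.mem_product, Finset.mem_range] at hp
        refine (volume_cell_diff_le hmid' (fun i => ⟨hv i, mem_starSimplex_self v i⟩) hp.2.1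
          (by omega) hp.2.2 _).trans ?_
        rw [hYA]
        gcongr
        have : p.1 ≤ 2 * (d + 1) + 1 := by omega
        exact_mod_cast this
    _ ≤ _ := by
        rw [Finset.sum_const, nsmul_eq_mul]
        gcongr
        have hcard : J.card ≤ (2 * (d + 1) + 2) * (2 ^ j + 1) ^ d := by
          refine (Finset.card_filter_le _ _).trans_eq ?_
          simp [I, Finset.card_product]
        rw [← ENNReal.ofReal_natCast]
        apply ENNReal.ofReal_le_ofReal
        exact_mod_cast hcard

theorem exists_volume_starSimplex_diff_le (d : ℕ) : ∃ η C : ℝ, 0 < η ∧ η ≤ 1 ∧ 0 ≤ C ∧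
    ∀ A E : Set (Fin (d + 1) → ℝ), (∀ a ∈ A, ∀ b ∈ A, (2⁻¹ : ℝ) • (a + b) ∈ A ∪ E) →
      ∀ v : Fin (d + 1) → Fin (d + 1) → ℝ, (∀ i, v i ∈ A) →
        volume (starSimplex v \ A) ≤
          2 * volume ((starSimplex v \ A) ∩ contractedSpan A η) +
            ENNReal.ofReal C * volume (E ∩ starSimplex v) := by
  set K : ℝ := (2 * (d + 1) + 2) * 2 ^ d * (2 * (d + 1) + 1) ^ (d + 1) with hK
  obtain ⟨j, hj⟩ := pow_unbounded_of_one_lt (2 * K + (d + 1)) (one_lt_two (α := ℝ))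
  have hK0 : 0 ≤ K := by positivity
  have hjd : d + 1 ≤ 2 ^ j := by
    have : ((d + 1 : ℕ) : ℝ) ≤ (2 ^ j : ℕ) := by
      push_cast
      linarith
    exact_mod_cast this
  have hN1 : (1 : ℝ) ≤ 2 ^ j := one_le_pow₀ one_le_two
  set B : ℝ := (2 * (d + 1) + 2) * (2 ^ j + 1) ^ d with hB
  set D : ℝ := (2 ^ j + 1) ^ 2 * (2 ^ j) ^ (d + 1) with hD
  refine ⟨(2 ^ j)⁻¹, 2 * (B * D), by positivity, inv_le_one_of_one_le₀ hN1, by positivity, ?_⟩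
  intro A E hmid v hv
  have hcoef : B * ((2 * (d + 1) + 1) / 2 ^ j) ^ (d + 1) ≤ 2⁻¹ := by
    have h1 : ((2 : ℝ) ^ j + 1) ^ d ≤ 2 ^ d * (2 ^ j) ^ d := by
      rw [← mul_pow]
      gcongr
      linarith
    calc B * ((2 * (d + 1) + 1) / 2 ^ j) ^ (d + 1)
        ≤ (2 * (d + 1) + 2) * (2 ^ d * (2 ^ j) ^ d) * ((2 * (d + 1) + 1) / 2 ^ j) ^ (d + 1) := by
          rw [hB]
          gcongr
      _ = K / 2 ^ j := by
          rw [hK, div_pow, pow_succ ((2 : ℝ) ^ j)]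
          field_simp
      _ ≤ 2⁻¹ := by
          rw [div_le_iff₀ (by positivity)]
          have : (0 : ℝ) ≤ d := by positivity
          linarith
  have hs := volume_starSimplex_strip_le hjd hmid hv
  set X := volume (starSimplex v \ A)
  set P := volume ((starSimplex v \ A) ∩ contractedSpan A (2 ^ j)⁻¹)
  set F := volume (E ∩ starSimplex v)
  have hX : X ≠ ⊤ := ((measure_mono sdiff_subset).trans_lt (volume_starSimplex_lt_top v)).ne
  have h1 : X ≤ P + (2⁻¹ * X + ENNReal.ofReal (B * D) * F) := by
    calc X ≤ P + volume ((starSimplex v \ A) \ contractedSpan A (2 ^ j)⁻¹) :=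
          measure_le_inter_add_sdiff _ _ _
      _ ≤ _ := by
          gcongr
          refine hs.trans ?_
          rw [mul_add, ← mul_assoc, ← mul_assoc, ← ENNReal.ofReal_mul (by positivity),
            ← ENNReal.ofReal_mul (by positivity)]
          gcongr
          rw [show (2⁻¹ : ENNReal) = ENNReal.ofReal 2⁻¹ by
            rw [ENNReal.ofReal_inv_of_pos two_pos, ENNReal.ofReal_ofNat]]
          exact ENNReal.ofReal_le_ofReal hcoef
  have h2 : X + X ≤ X + (2 * P + ENNReal.ofReal (2 * (B * D)) * F) := by
    calc X + X = 2 * X := (two_mul X).symm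
      _ ≤ 2 * (P + (2⁻¹ * X + ENNReal.ofReal (B * D) * F)) := by gcongr
      _ = _ := by
          rw [ENNReal.ofReal_mul two_pos.le, ENNReal.ofReal_ofNat, mul_add, mul_add, ← mul_assoc,
            ENNReal.mul_inv_cancel two_ne_zero ENNReal.ofNat_ne_top, one_mul, mul_assoc]
          ring
  exact (ENNReal.add_le_add_iff_left hX).1 h2

section LinearProgram

variable {V ι : Type*} [AddCommGroup V] [Module ℝ V] [Fintype ι]

open Classical in
theorem exists_smaller_support {u : ι → V} {c : ι → ℝ} (hc : ∀ j, 0 < c j) {l : ι → ℝ}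
    (hl : ∀ j, 0 ≤ l j)
    (hdep : ¬ LinearIndepOn ℝ u (Finset.univ.filter fun j => l j ≠ 0 : Finset ι)) :
    ∃ l' : ι → ℝ, (∀ j, 0 ≤ l' j) ∧ ∑ j, l' j • u j = ∑ j, l j • u j ∧
      ∑ j, c j * l' j ≤ ∑ j, c j * l j ∧
      (Finset.univ.filter fun j => l' j ≠ 0).card < (Finset.univ.filter fun j => l j ≠ 0).card := by
  set s := Finset.univ.filter fun j => l j ≠ 0 with hs
  obtain ⟨f, hf0, i₀, hi₀, hfi₀⟩ := not_linearIndepOn_finset_iff.1 hdep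
  have hposs : ∀ j ∈ s, 0 < l j := fun j hj =>
    lt_of_le_of_ne (hl j) (Ne.symm (Finset.mem_filter.1 hj).2)
  have key : ∃ a : ι → ℝ, (∀ j ∉ s, a j = 0) ∧ ∑ j, a j • u j = 0 ∧ 0 ≤ ∑ j, c j * a j ∧
      ∃ i, 0 < a i := by
    have aux : ∀ a : ι → ℝ, a i₀ ≠ 0 → 0 ≤ ∑ j, c j * a j → ∃ i, 0 < a i := by
      intro a ha h
      by_contra! hcon
      have : ∑ j, c j * a j < ∑ j : ι, 0 :=
        Finset.sum_lt_sum (fun j _ => mul_nonpos_of_nonneg_of_nonpos (hc j).le (hcon j))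
          ⟨i₀, Finset.mem_univ _, mul_neg_of_pos_of_neg (hc i₀) (lt_of_le_of_ne (hcon i₀) ha)⟩
      simp at this
      linarith
    let g : ι → ℝ := fun j => if j ∈ s then f j else 0
    have hg0 : ∑ j, g j • u j = 0 := by
      rw [← hf0]
      simp only [g, ite_smul, zero_smul, Finset.sum_ite_mem, Finset.univ_inter]
    have hgi : g i₀ ≠ 0 := by simpa only [g, if_pos hi₀] using hfi₀
    rcases le_total 0 (∑ j, c j * g j) with h | h
    · exact ⟨g, fun j hj => if_neg hj, hg0, h, aux g hgi h⟩
    · have h' : 0 ≤ ∑ j, c j * (-g) j := by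
        simp only [Pi.neg_apply, mul_neg, Finset.sum_neg_distrib]
        linarith
      refine ⟨-g, fun j hj => ?_, ?_, h', aux (-g) (by simpa using hgi) h'⟩
      · simp [g, hj]
      · simp only [Pi.neg_apply, neg_smul, Finset.sum_neg_distrib, hg0, neg_zero]
  obtain ⟨a, has, ha0, hca, i, hi⟩ := key
  obtain ⟨q, hq, hmin⟩ := Finset.exists_min_image (Finset.univ.filter fun j => 0 < a j)
    (fun j => l j / a j) ⟨i, by simpa using hi⟩
  have hq' : 0 < a q := by simpa using hq
  have hqs : q ∈ s := by
    by_contra h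
    exact hq'.ne' (has q h)
  have ht : 0 ≤ l q / a q := div_nonneg (hl q) hq'.le
  refine ⟨fun j => l j - l q / a q * a j, fun j => ?_, ?_, ?_, ?_⟩
  · rcases lt_or_ge 0 (a j) with h | h
    · have := hmin j (by simpa using h)
      rw [le_div_iff₀ h] at this
      linarith
    · have := mul_nonpos_of_nonneg_of_nonpos ht h
      linarith [hl j]
  · simp only [sub_smul, mul_smul, Finset.sum_sub_distrib, ← Finset.smul_sum, ha0, smul_zero,
      sub_zero]
  · have : ∑ j, c j * (l j - l q / a q * a j) =
        ∑ j, c j * l j - l q / a q * ∑ j, c j * a j := by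
      rw [Finset.mul_sum, ← Finset.sum_sub_distrib]
      exact Finset.sum_congr rfl fun j _ => by ring
    rw [this]
    have := mul_nonneg ht hca
    linarith
  · refine Finset.card_lt_card ((Finset.ssubset_iff_of_subset ?_).2 ⟨q, hqs, ?_⟩)
    · intro j hj
      by_contra h
      have h1 : l j = 0 := by
        by_contra h2
        exact h (by simp [hs, h2])
      simp [h1, has j h] at hj
    · simp [hq'.ne']

open Classical in
/-- A feasible linear program with positive costs has a minimizer whose support is linearly
independent. -/
theorem exists_minimizer_linearIndepOn {k : ℕ} {u : ι → Fin k → ℝ} {c : ι → ℝ}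
    (hc : ∀ j, 1 ≤ c j) {l₀ : ι → ℝ} (hl₀ : ∀ j, 0 ≤ l₀ j) :
    ∃ l : ι → ℝ, (∀ j, 0 ≤ l j) ∧ ∑ j, l j • u j = ∑ j, l₀ j • u j ∧
      (∀ l' : ι → ℝ, (∀ j, 0 ≤ l' j) → ∑ j, l' j • u j = ∑ j, l₀ j • u j →
        ∑ j, c j * l j ≤ ∑ j, c j * l' j) ∧
      LinearIndepOn ℝ u (Finset.univ.filter fun j => l j ≠ 0 : Finset ι) := by
  let F : Set (ι → ℝ) := {l | (∀ j, 0 ≤ l j) ∧ ∑ j, l j • u j = ∑ j, l₀ j • u j}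
  have hFcl : IsClosed F := by
    apply IsClosed.inter
    · have : IsClosed (Ici (0 : ι → ℝ)) := isClosed_Ici
      exact this
    · exact isClosed_eq (by fun_prop) continuous_const
  have hcont : Continuous fun l : ι → ℝ => ∑ j, c j * l j := by fun_prop
  let K := F ∩ {l | ∑ j, c j * l j ≤ ∑ j, c j * l₀ j}
  have hK : IsCompact K := by
    refine (isCompact_Icc (a := (0 : ι → ℝ)) (b := fun _ => ∑ j, c j * l₀ j)).of_isClosed_subset
      (hFcl.inter (isClosed_le hcont continuous_const)) ?_
    rintro l ⟨⟨hl, -⟩, hlc⟩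
    refine ⟨hl, fun j => ?_⟩
    calc l j ≤ c j * l j := le_mul_of_one_le_left (hl j) (hc j)
      _ ≤ ∑ j, c j * l j := Finset.single_le_sum (f := fun j => c j * l j)
          (fun j _ => mul_nonneg (zero_le_one.trans (hc j)) (hl j)) (Finset.mem_univ j)
      _ ≤ _ := hlc
  obtain ⟨l₁, hl₁, hmin⟩ := hK.exists_isMinOn
    ⟨l₀, ⟨hl₀, rfl⟩, le_refl (∑ j, c j * l₀ j)⟩ hcont.continuousOn
  have hmin' : ∀ l' ∈ F, ∑ j, c j * l₁ j ≤ ∑ j, c j * l' j := by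
    intro l' hl'
    by_cases h : ∑ j, c j * l' j ≤ ∑ j, c j * l₀ j
    · exact hmin ⟨hl', h⟩
    · exact hl₁.2.trans (not_le.1 h).le
  let G : Set (ι → ℝ) := {l | l ∈ F ∧ ∑ j, c j * l j ≤ ∑ j, c j * l₁ j}
  let N : (ι → ℝ) → ℕ := fun l => (Finset.univ.filter fun j => l j ≠ 0).card
  have hG : G.Nonempty := ⟨l₁, hl₁.1, le_rfl⟩
  have hargmin := fun l (hl : l ∈ G) => Function.argminOn_le N G hl
  have hmem := Function.argminOn_mem N G hG
  set l := Function.argminOn N G hG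
  refine ⟨l, hmem.1.1, hmem.1.2, fun l' h1 h2 => hmem.2.trans (hmin' l' ⟨h1, h2⟩), ?_⟩
  by_contra hdep
  obtain ⟨l', h1, h2, h3, h4⟩ :=
    exists_smaller_support (fun j => zero_lt_one.trans_le (hc j)) hmem.1.1 hdep
  exact absurd (hargmin l' ⟨⟨h1, h2.trans hmem.1.2⟩, h3.trans hmem.2⟩) (not_le.2 h4)

end LinearProgram

/-- Costs in a small interval such that no linear functional agrees with the costs on a basis and
on a further point. -/
theorem exists_generic_costs {k M : ℕ} (u : Fin M → Fin k → ℝ) {η : ℝ} (hη : 0 < η) :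
    ∃ c : Fin M → ℝ, (∀ j, c j ∈ Icc 1 (1 + η)) ∧
      ∀ S : Fin k → Fin M, LinearIndependent ℝ (u ∘ S) → ∀ f : (Fin k → ℝ) →ₗ[ℝ] ℝ,
        (∀ i, f (u (S i)) = c (S i)) → ∀ j ∉ range S, f (u j) ≠ c j := by
  let B : (Fin k → Fin M) × Fin M → Set (Fin M → ℝ) := fun p =>
    {c | LinearIndependent ℝ (u ∘ p.1) ∧ p.2 ∉ range p.1 ∧ ∃ f : (Fin k → ℝ) →ₗ[ℝ] ℝ,
      (∀ i, f (u (p.1 i)) = c (p.1 i)) ∧ f (u p.2) = c p.2}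
  have hB : ∀ p, volume (B p) = 0 := by
    rintro ⟨S, j⟩
    by_cases hp : LinearIndependent ℝ (u ∘ S) ∧ j ∉ range S
    · obtain ⟨hS, hj⟩ := hp
      have hspan := hS.span_eq_top_of_card_eq_finrank' (by simp)
      let b := Module.Basis.mk hS hspan.ge
      let L : (Fin M → ℝ) →ₗ[ℝ] ℝ :=
        ∑ i, b.repr (u j) i • LinearMap.proj (S i) - LinearMap.proj j
      have hL : ∀ c, L c = ∑ i, b.repr (u j) i * c (S i) - c j := by
        intro c
        simp [L, LinearMap.sum_apply]
      refine measure_mono_null (t := (LinearMap.ker L : Set (Fin M → ℝ))) ?_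
        (Measure.addHaar_submodule _ _ ?_)
      · rintro c ⟨-, -, f, hf, hfj⟩
        rw [SetLike.mem_coe, LinearMap.mem_ker, hL, sub_eq_zero]
        change f (u j) = c j at hfj
        rw [← hfj]
        conv_rhs => rw [← b.sum_repr (u j), map_sum]
        refine Finset.sum_congr rfl fun i _ => ?_
        rw [map_smul, smul_eq_mul, Module.Basis.mk_apply, Function.comp_apply, hf i]
      · intro htop
        have h1 : L (Pi.single j 1) = 0 := LinearMap.ker_eq_top.1 htop ▸ rfl
        have h2 : ∀ i, (Pi.single j 1 : Fin M → ℝ) (S i) = 0 := fun i =>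
          Pi.single_eq_of_ne (M := fun _ => ℝ) (fun h => hj ⟨i, h⟩) 1
        rw [hL] at h1
        simp [h2] at h1
    · have : B (S, j) = ∅ := by
        ext c
        simp only [B, mem_ofPred_eq, mem_empty_iff_false, iff_false]
        exact fun h => hp ⟨h.1, h.2.1⟩
      rw [this, measure_empty]
  have hU : volume (⋃ p, B p) = 0 := measure_iUnion_null hB
  have hbox : volume (Icc (fun _ => 1) (fun _ => 1 + η) : Set (Fin M → ℝ)) ≠ 0 := by
    rw [Real.volume_Icc_pi]
    simp [hη]
  obtain ⟨c, hc, hcB⟩ : ∃ c ∈ (Icc (fun _ => 1) (fun _ => 1 + η) : Set (Fin M → ℝ)),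
      c ∉ ⋃ p, B p := by
    by_contra! h
    exact hbox (measure_mono_null h hU)
  refine ⟨c, fun j => ⟨hc.1 j, hc.2 j⟩, fun S hS f hf j hj hfj => hcB ?_⟩
  exact mem_iUnion.2 ⟨(S, j), hS, hj, f, hf, hfj⟩

/-- The vertices `u ∘ S` form a basis, and the linear functional with the prescribed costs there
is a lower bound for all the costs. -/
def IsLowerBasis {k M : ℕ} (u : Fin M → Fin k → ℝ) (c : Fin M → ℝ) (S : Fin k → Fin M) : Prop :=
  StrictMono S ∧ LinearIndependent ℝ (u ∘ S) ∧ ∃ f : (Fin k → ℝ) →ₗ[ℝ] ℝ,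
    (∀ i, f (u (S i)) = c (S i)) ∧ ∀ j, f (u j) ≤ c j

theorem volume_starSimplex_inter_eq_zero {k M : ℕ} {u : Fin M → Fin k → ℝ} {c : Fin M → ℝ}
    (hgen : ∀ S : Fin k → Fin M, LinearIndependent ℝ (u ∘ S) → ∀ f : (Fin k → ℝ) →ₗ[ℝ] ℝ,
        (∀ i, f (u (S i)) = c (S i)) → ∀ j ∉ range S, f (u j) ≠ c j)
    {S S' : Fin k → Fin M} (hS : IsLowerBasis u c S) (hS' : IsLowerBasis u c S') (hne : S ≠ S') :
    volume (starSimplex (u ∘ S) ∩ starSimplex (u ∘ S')) = 0 := by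
  obtain ⟨hmono, hli, f, hf, hfl⟩ := hS
  obtain ⟨hmono', hli', f', hf', hfl'⟩ := hS'
  have hff : f - f' ≠ 0 := by
    intro h
    have h := sub_eq_zero.1 h
    subst h
    apply hne
    rw [← hmono.range_inj hmono']
    apply Subset.antisymm
    · rintro _ ⟨i, rfl⟩
      by_contra hi
      exact hgen S' hli' f hf' _ hi (hf i)
    · rintro _ ⟨i, rfl⟩
      by_contra hi
      exact hgen S hli f hf _ hi (hf' i)
  refine measure_mono_null (t := (LinearMap.ker (f - f') : Set (Fin k → ℝ))) ?_
    (Measure.addHaar_submodule _ _ fun h => hff (LinearMap.ker_eq_top.1 h))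
  have aux : ∀ (S : Fin k → Fin M) (f f' : (Fin k → ℝ) →ₗ[ℝ] ℝ), (∀ i, f (u (S i)) = c (S i)) →
      (∀ j, f' (u j) ≤ c j) → ∀ x ∈ starSimplex (u ∘ S), f' x ≤ f x := by
    rintro S f f' hf hf' _ ⟨l, hl0, -, rfl⟩
    simp only [map_sum, map_smul, smul_eq_mul, Function.comp_apply]
    refine Finset.sum_le_sum fun i _ => mul_le_mul_of_nonneg_left ?_ (hl0 i)
    rw [hf]
    exact hf' _
  rintro x ⟨hx, hx'⟩
  rw [SetLike.mem_coe, LinearMap.mem_ker, LinearMap.sub_apply, sub_eq_zero]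
  exact le_antisymm (aux S' f' f hf' hfl x hx') (aux S f f' hf hfl' x hx)

theorem exists_isLowerBasis {k M : ℕ} {u : Fin M → Fin k → ℝ} {c : Fin M → ℝ}
    (hc : ∀ j, 1 ≤ c j) {x : Fin k → ℝ}
    (hx : ∀ s : Set (Fin M), x ∈ Submodule.span ℝ (u '' s) → Submodule.span ℝ (u '' s) = ⊤)
    {l₀ : Fin M → ℝ} (hl₀ : ∀ j, 0 ≤ l₀ j) (hx₀ : ∑ j, l₀ j • u j = x)
    (hl₁ : ∑ j, c j * l₀ j ≤ 1) :
    ∃ S : Fin k → Fin M, IsLowerBasis u c S ∧ x ∈ starSimplex (u ∘ S) := by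
  classical
  obtain ⟨l, hl, hlx, hmin, hli⟩ := exists_minimizer_linearIndepOn (u := u) hc hl₀
  rw [hx₀] at hlx hmin
  set s := Finset.univ.filter fun j => l j ≠ 0 with hs
  have hls : ∀ j ∉ s, l j = 0 := fun j hj => by simpa [hs] using hj
  have hsumx : ∑ j ∈ s, l j • u j = x := by
    rw [← hlx]
    refine Finset.sum_subset (Finset.subset_univ _) fun j _ hj => ?_
    rw [hls j hj, zero_smul]
  have hspan : Submodule.span ℝ (u '' s) = ⊤ := by
    apply hx
    rw [← hsumx]
    exact Submodule.sum_mem _ fun j hj =>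
      Submodule.smul_mem _ _ (Submodule.subset_span ⟨j, hj, rfl⟩)
  have hcard : s.card = k := by
    have hr : range (fun j : (s : Set (Fin M)) => u j) = u '' s := by
      rw [image_eq_range]
    have hb := Module.finrank_eq_card_basis (Module.Basis.mk hli.linearIndependent_restrict
      (by rw [← hspan]; exact (congrArg _ hr.symm).le))
    rw [Module.finrank_fin_fun] at hb
    simpa using hb.symm
  let S := s.orderEmbOfFin hcard
  have hSr : range S = s := Finset.range_orderEmbOfFin s hcard
  have hSli : LinearIndependent ℝ (u ∘ S) := by
    rw [← linearIndepOn_range_iff S.injective, hSr]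
    exact hli
  have hSspan := hSli.span_eq_top_of_card_eq_finrank' (by simp)
  let b := Module.Basis.mk hSli hSspan.ge
  have hb : ∀ i, b i = u (S i) := fun i => by simp [b]
  let f : (Fin k → ℝ) →ₗ[ℝ] ℝ := b.constr ℝ fun i => c (S i)
  have hf : ∀ i, f (u (S i)) = c (S i) := fun i => by
    rw [← hb, Module.Basis.constr_basis]
  have hSs : ∀ i, S i ∈ s := fun i => by
    rw [← Finset.mem_coe, ← hSr]; exact ⟨i, rfl⟩
  have hre : ∀ {W : Type} [AddCommMonoid W] (g : Fin M → W), ∑ j ∈ s, g j = ∑ i, g (S i) := by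
    intro W _ g
    have : s = Finset.univ.map S.toEmbedding := by
      rw [← Finset.coe_inj, ← hSr]; simp
    conv_lhs => rw [this, Finset.sum_map]
    rfl
  have hcost : ∑ i, l (S i) ≤ 1 := by
    rw [← hre fun j => l j]
    calc ∑ j ∈ s, l j ≤ ∑ j, l j :=
          Finset.sum_le_sum_of_subset_of_nonneg (Finset.subset_univ _) fun j _ _ => hl j
      _ ≤ ∑ j, c j * l j := Finset.sum_le_sum fun j _ => le_mul_of_one_le_left (hl j) (hc j)
      _ ≤ 1 := (hmin l₀ hl₀ hx₀).trans hl₁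
  refine ⟨S, ⟨S.strictMono, hSli, f, hf, fun j => ?_⟩, fun i => l (S i), fun i => hl _, hcost, ?_⟩
  · by_contra! hj
    let a : Fin M → ℝ := fun q => ∑ i, if S i = q then b.repr (u j) i else 0
    have haS : ∀ i, a (S i) = b.repr (u j) i := by
      intro i
      simp [a, S.injective.eq_iff]
    have ha0 : ∀ q ∉ s, a q = 0 := by
      intro q hq
      refine Finset.sum_eq_zero fun i _ => if_neg ?_
      rintro rfl
      exact hq (hSs i)
    have hau : ∑ q, a q • u q = u j := by
      rw [← Finset.sum_subset (Finset.subset_univ s) (fun q _ hq => by rw [ha0 q hq, zero_smul]),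
        hre fun q => a q • u q]
      conv_rhs => rw [← b.sum_repr (u j)]
      exact Finset.sum_congr rfl fun i _ => by rw [haS, hb]
    have hac : ∑ q, c q * a q = f (u j) := by
      rw [← hau, map_sum]
      refine Finset.sum_congr rfl fun q _ => ?_
      by_cases hq : q ∈ s
      · obtain ⟨i, rfl⟩ : q ∈ range S := by rw [hSr]; exact hq
        rw [map_smul, smul_eq_mul, hf, mul_comm]
      · rw [ha0 q hq]; simp
    obtain ⟨ε, hε, hεa⟩ : ∃ ε > 0, ∀ q ∈ s, ε * a q ≤ l q := by
      have : ∀ q ∈ s, ∀ᶠ ε : ℝ in nhdsWithin 0 (Ioi 0), ε * a q ≤ l q := by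
        intro q hq
        have hlq : 0 < l q := lt_of_le_of_ne (hl q) (Ne.symm (Finset.mem_filter.1 hq).2)
        have ht : Filter.Tendsto (fun ε : ℝ => ε * a q) (nhdsWithin 0 (Ioi 0)) (nhds 0) := by
          have : Continuous fun ε : ℝ => ε * a q := by fun_prop
          simpa using (this.tendsto 0).mono_left nhdsWithin_le_nhds
        exact (ht.eventually_lt_const hlq).mono fun _ h => h.le
      have h := (Filter.eventually_all_finset s).2 this
      obtain ⟨ε, h1, h2⟩ := (h.and self_mem_nhdsWithin).exists
      exact ⟨ε, h2, h1⟩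
    let l' : Fin M → ℝ := fun q => l q - ε * a q + ε * (Pi.single j 1 : Fin M → ℝ) q
    have hsingle : ∀ q, 0 ≤ (Pi.single j 1 : Fin M → ℝ) q := by
      intro q
      rw [Pi.single_apply]
      split_ifs <;> norm_num
    have hl'0 : ∀ q, 0 ≤ l' q := by
      intro q
      have h1 : ε * a q ≤ l q := by
        by_cases hq : q ∈ s
        · exact hεa q hq
        · rw [ha0 q hq, mul_zero]; exact hl q
      have h2 := mul_nonneg hε.le (hsingle q)
      simp only [l']
      linarith
    have hl'x : ∑ q, l' q • u q = x := by
      simp only [l', add_smul, sub_smul, mul_smul, Finset.sum_add_distrib,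
        Finset.sum_sub_distrib, ← Finset.smul_sum, hau, hlx]
      simp [Pi.single_apply]
    have hl'c : ∑ q, c q * l' q = ∑ q, c q * l q - ε * f (u j) + ε * c j := by
      rw [← hac, Finset.mul_sum]
      have : ε * c j = ∑ q, ε * (c q * (Pi.single j 1 : Fin M → ℝ) q) := by
        rw [← Finset.mul_sum]; simp [Pi.single_apply]
      rw [this, ← Finset.sum_sub_distrib, ← Finset.sum_add_distrib]
      exact Finset.sum_congr rfl fun q _ => by simp only [l']; ring
    have := hmin l' hl'0 hl'x
    rw [hl'c] at this
    nlinarith [mul_pos hε (sub_pos.2 hj)]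
  · rw [← hsumx, hre fun j => l j • u j]
    rfl

/-- Finitely many vectors span a system of almost disjoint simplices with apex at the origin that
covers almost all of a slightly contracted hull. -/
theorem exists_starTriangulation {k M : ℕ} (u : Fin M → Fin k → ℝ) {η : ℝ} (hη : 0 < η) :
    ∃ 𝒮 : Finset (Fin k → Fin M),
      (∀ S ∈ 𝒮, ∀ S' ∈ 𝒮, S ≠ S' →
        volume (starSimplex (u ∘ S) ∩ starSimplex (u ∘ S')) = 0) ∧
      ∀ᵐ x : Fin k → ℝ, (∃ l : Fin M → ℝ, (∀ j, 0 ≤ l j) ∧ ∑ j, l j ≤ 1 - η ∧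
        ∑ j, l j • u j = x) → ∃ S ∈ 𝒮, x ∈ starSimplex (u ∘ S) := by
  classical
  obtain ⟨c, hc, hgen⟩ := exists_generic_costs u hη
  refine ⟨Finset.univ.filter (IsLowerBasis u c), fun S hS S' hS' hne => ?_, ?_⟩
  · exact volume_starSimplex_inter_eq_zero hgen (Finset.mem_filter.1 hS).2
      (Finset.mem_filter.1 hS').2 hne
  have hae : ∀ᵐ x : Fin k → ℝ, ∀ s : Set (Fin M),
      x ∈ Submodule.span ℝ (u '' s) → Submodule.span ℝ (u '' s) = ⊤ := by
    rw [ae_all_iff]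
    intro s
    by_cases h : Submodule.span ℝ (u '' s) = ⊤
    · exact Filter.Eventually.of_forall fun _ _ => h
    · have h0 := Measure.addHaar_submodule volume _ h
      filter_upwards [measure_eq_zero_iff_ae_notMem.1 h0] with x hx hx'
      exact absurd hx' hx
  filter_upwards [hae] with x hx
  rintro ⟨l, hl, hl1, hlx⟩
  obtain ⟨S, hS, hxS⟩ := exists_isLowerBasis (fun j => (hc j).1) hx hl hlx (by
    calc ∑ j, c j * l j ≤ ∑ j, (1 + η) * l j :=
          Finset.sum_le_sum fun j _ => mul_le_mul_of_nonneg_right (hc j).2 (hl j)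
      _ = (1 + η) * ∑ j, l j := by rw [Finset.mul_sum]
      _ ≤ (1 + η) * (1 - η) := by gcongr
      _ ≤ 1 := by nlinarith)
  exact ⟨S, Finset.mem_filter.2 ⟨Finset.mem_univ _, hS⟩, hxS⟩

theorem isCompact_starSimplex {k : ℕ} (v : Fin k → Fin k → ℝ) : IsCompact (starSimplex v) := by
  have hK : IsCompact {l : Fin k → ℝ | (∀ i, 0 ≤ l i) ∧ ∑ i, l i ≤ 1} := by
    refine (isCompact_Icc (a := (0 : Fin k → ℝ)) (b := fun _ => 1)).of_isClosed_subset ?_ ?_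
    · have h0 : IsClosed (Ici (0 : Fin k → ℝ)) := isClosed_Ici
      exact IsClosed.inter h0 (isClosed_le
        (continuous_finsetSum _ fun i _ => continuous_apply i) continuous_const)
    · rintro l ⟨hl, hl1⟩
      exact ⟨hl, fun i => (Finset.single_le_sum (fun i _ => hl i) (Finset.mem_univ i)).trans hl1⟩
  have heq : starSimplex v = (fun l : Fin k → ℝ => ∑ i, l i • v i) ''
      {l : Fin k → ℝ | (∀ i, 0 ≤ l i) ∧ ∑ i, l i ≤ 1} := by
    ext x
    exact ⟨fun ⟨l, h0, h1, h⟩ => ⟨l, ⟨h0, h1⟩, h⟩, fun ⟨l, ⟨h0, h1⟩, h⟩ => ⟨l, h0, h1, h⟩⟩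
  rw [heq]
  exact hK.image (by fun_prop)

theorem convexHull_range_subset {k M : ℕ} (u : Fin M → Fin k → ℝ) :
    convexHull ℝ (range u) ⊆
      {x | ∃ l : Fin M → ℝ, (∀ j, 0 ≤ l j) ∧ ∑ j, l j ≤ 1 ∧ ∑ j, l j • u j = x} := by
  classical
  refine convexHull_min ?_ ?_
  · rintro _ ⟨j, rfl⟩
    refine ⟨Pi.single j 1, fun i => ?_, by simp, by simp [Pi.single_apply]⟩
    rw [Pi.single_apply]
    split_ifs <;> norm_num
  · rintro _ ⟨l, hl0, hl1, rfl⟩ _ ⟨l', hl0', hl1', rfl⟩ a b ha hb hab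
    refine ⟨fun j => a * l j + b * l' j, fun j => ?_, ?_, ?_⟩
    · have := hl0 j
      have := hl0' j
      positivity
    · rw [Finset.sum_add_distrib, ← Finset.mul_sum, ← Finset.mul_sum]
      nlinarith
    · simp only [add_smul, mul_smul, Finset.sum_add_distrib, Finset.smul_sum]

theorem exists_volume_convexHull_le_add {d : ℕ} {r R : ℝ} (hr : 0 < r) (hR : 0 < R) :
    ∃ C : ℝ, 0 ≤ C ∧ ∀ A E : Set (Fin (d + 1) → ℝ), A ⊆ Metric.closedBall 0 R →
      (∀ a ∈ A, ∀ b ∈ A, (2⁻¹ : ℝ) • (a + b) ∈ A ∪ E) →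
      volume (Metric.closedBall 0 r \ A) ≤ volume E →
      ∀ (M : ℕ) (u : Fin M → Fin (d + 1) → ℝ), (∀ j, u j ∈ A) →
        volume (convexHull ℝ (range u)) ≤ volume A + ENNReal.ofReal C * volume E := by
  obtain ⟨η, C₁, hη, hη1, hC₁, hsimp⟩ := exists_volume_starSimplex_diff_le d
  obtain ⟨C₂, hC₂, hInterior⟩ :=
    exists_volume_contractedSpan_diff_le (Nat.le_add_left 1 d) hr hR hη hη1
  refine ⟨2 * C₂ + C₁, by positivity, fun A E hA hmid hball M u hu => ?_⟩
  have key : ∀ ε : ℝ, 0 < ε → ε < 1 →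
      ENNReal.ofReal ((1 - ε) ^ (d + 1)) * volume (convexHull ℝ (range u)) ≤
        volume A + ENNReal.ofReal (2 * C₂ + C₁) * volume E := by
    intro ε hε hε1
    obtain ⟨𝒮, hdisj, hcov⟩ := exists_starTriangulation u hε
    have hsum : ∀ G : Set (Fin (d + 1) → ℝ),
        ∑ S ∈ 𝒮, volume (starSimplex (u ∘ S) ∩ G) ≤ volume G := by
      intro G
      have hm : ∀ S : Fin (d + 1) → Fin M, MeasurableSet (starSimplex (u ∘ S)) :=
        fun S => (isCompact_starSimplex _).measurableSet
      calc ∑ S ∈ 𝒮, volume (starSimplex (u ∘ S) ∩ G)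
          = ∑ S ∈ 𝒮, volume.restrict G (starSimplex (u ∘ S)) :=
            Finset.sum_congr rfl fun S _ => (Measure.restrict_apply (hm S)).symm
        _ = volume.restrict G (⋃ S ∈ 𝒮, starSimplex (u ∘ S)) := by
            refine (measure_biUnion_finset₀ ?_ fun S _ => (hm S).nullMeasurableSet).symm
            intro S hS S' hS' hne
            exact nonpos_iff_eq_zero.1
              ((Measure.restrict_apply_le _ _).trans (hdisj S hS S' hS' hne).le)
        _ ≤ volume.restrict G univ := measure_mono (subset_univ _)
        _ = volume G := Measure.restrict_apply_univ _
    have hsmul : ENNReal.ofReal ((1 - ε) ^ (d + 1)) * volume (convexHull ℝ (range u)) =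
        volume ((1 - ε) • convexHull ℝ (range u)) := by
      rw [Measure.addHaar_smul, Module.finrank_fin_fun,
        abs_of_nonneg (pow_nonneg (by linarith) _)]
    have hle : volume ((1 - ε) • convexHull ℝ (range u)) ≤
        volume (⋃ S ∈ 𝒮, starSimplex (u ∘ S)) := by
      apply measure_mono_ae
      filter_upwards [hcov] with x hx hxc
      obtain ⟨y, hy, rfl⟩ := hxc
      obtain ⟨l, hl0, hl1, rfl⟩ := convexHull_range_subset u hy
      obtain ⟨S, hS, hxS⟩ := hx ⟨fun j => (1 - ε) * l j,
        fun j => mul_nonneg (by linarith) (hl0 j), by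
          rw [← Finset.mul_sum]
          exact mul_le_of_le_one_right (by linarith) hl1, by
          simp only [mul_smul, Finset.smul_sum]⟩
      exact mem_iUnion₂.2 ⟨S, hS, hxS⟩
    have hdiff : ⋃ S ∈ 𝒮, starSimplex (u ∘ S) ⊆ A ∪ ⋃ S ∈ 𝒮, (starSimplex (u ∘ S) \ A) := by
      intro x hx
      obtain ⟨S, hS, hxS⟩ := mem_iUnion₂.1 hx
      by_cases h : x ∈ A
      · exact Or.inl h
      · exact Or.inr (mem_iUnion₂.2 ⟨S, hS, hxS, h⟩)
    rw [hsmul]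
    refine (hle.trans ((measure_mono hdiff).trans (measure_union_le _ _))).trans ?_
    gcongr
    calc volume (⋃ S ∈ 𝒮, (starSimplex (u ∘ S) \ A))
        ≤ ∑ S ∈ 𝒮, volume (starSimplex (u ∘ S) \ A) := measure_biUnion_finset_le _ _
      _ ≤ ∑ S ∈ 𝒮, (2 * volume (starSimplex (u ∘ S) ∩ (contractedSpan A η \ A)) +
            ENNReal.ofReal C₁ * volume (starSimplex (u ∘ S) ∩ E)) := by
          refine Finset.sum_le_sum fun S _ => ?_
          have h := hsimp A E hmid (u ∘ S) fun i => hu _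
          have heq : (starSimplex (u ∘ S) \ A) ∩ contractedSpan A η =
              starSimplex (u ∘ S) ∩ (contractedSpan A η \ A) := by
            ext x
            simp only [mem_inter_iff, mem_sdiff]
            tauto
          rwa [inter_comm E, heq] at h
      _ ≤ 2 * volume (contractedSpan A η \ A) + ENNReal.ofReal C₁ * volume E := by
          rw [Finset.sum_add_distrib, ← Finset.mul_sum, ← Finset.mul_sum]
          gcongr
          · exact hsum _
          · exact hsum _
      _ ≤ 2 * (ENNReal.ofReal C₂ * volume E) + ENNReal.ofReal C₁ * volume E := by
          gcongr
          exact hInterior A E hA hmid hball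
      _ = _ := by
          rw [ENNReal.ofReal_add (by positivity) hC₁, ENNReal.ofReal_mul two_pos.le,
            ENNReal.ofReal_ofNat, add_mul, mul_assoc]
  have htend : Filter.Tendsto
      (fun ε : ℝ => ENNReal.ofReal ((1 - ε) ^ (d + 1)) * volume (convexHull ℝ (range u)))
      (nhdsWithin 0 (Ioi 0)) (nhds (volume (convexHull ℝ (range u)))) := by
    have hc : Continuous fun ε : ℝ => ENNReal.ofReal ((1 - ε) ^ (d + 1)) :=
      ENNReal.continuous_ofReal.comp (by fun_prop)
    have h1 := (hc.tendsto 0).mono_left (nhdsWithin_le_nhds (s := Ioi 0))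
    simp only [sub_zero, one_pow, ENNReal.ofReal_one] at h1
    simpa using ENNReal.Tendsto.mul_const (b := volume (convexHull ℝ (range u))) h1
      (Or.inl one_ne_zero)
  refine le_of_tendsto htend ?_
  filter_upwards [Ioo_mem_nhdsGT (zero_lt_one (α := ℝ))] with ε hε
  exact key ε hε.1 hε.2

theorem exists_volume_convexHull_le_of_normalized (d : ℕ) {c : ℝ} (hc : 0 < c) :
    ∃ C : ℝ, 0 < C ∧ ∀ A : Set (Fin (d + 1) → ℝ), IsCompact A → ∀ a,
      A ⊆ Metric.closedBall a 1 → ENNReal.ofReal c ≤ volume A → ∀ δ : ℝ, 0 ≤ δ →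
      volume (A + A) ≤ ENNReal.ofReal (2 ^ (d + 1) + δ) * volume A →
      ∀ (M : ℕ) (u : Fin M → Fin (d + 1) → ℝ), (∀ j, u j ∈ A) →
        volume (convexHull ℝ (range u)) ≤ ENNReal.ofReal (1 + C * δ) * volume A := by
  obtain ⟨ρ, δ₀, hρ, hρ1, hδ₀, hcube⟩ := exists_cube_subset_midpoints (n := d) hc
  obtain ⟨C₁, hC₁, hcore⟩ := exists_volume_convexHull_le_add (d := d) (r := ρ / 4) (R := 3)
    (by positivity) (by norm_num)
  refine ⟨C₁ + 2 ^ (d + 1) / (c * δ₀), by positivity, ?_⟩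
  intro A hA a ha hcA δ hδ hd M u hu
  rcases le_or_gt δ δ₀ with hle | hgt
  · obtain ⟨x, hx, hball⟩ := hcube A hA a ha hcA δ hδ hle hd
    set g := x - fun _ => ρ / 2 with hg
    let A' := (fun y => y - g) '' A
    have hA'c : IsCompact A' := hA.image (by fun_prop)
    let D := (2⁻¹ : ℝ) • (A' + A')
    have htr : ∀ S : Set (Fin (d + 1) → ℝ), ∀ w, volume ((fun y => y - w) '' S) = volume S := by
      intro S w
      simp only [sub_eq_add_neg, image_add_right, neg_neg]
      exact measure_preimage_add_right _ _ _
    have hAD : A' ⊆ D := by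
      intro y hy
      refine ⟨y + y, ⟨y, hy, y, hy, rfl⟩, ?_⟩
      simp only
      rw [← two_smul ℝ y, inv_smul_smul₀ two_ne_zero]
    have hgx : ‖g - x‖ ≤ 1 := by
      rw [hg, sub_sub_cancel_left, norm_neg, pi_norm_le_iff_of_nonneg zero_le_one]
      intro i
      rw [Real.norm_of_nonneg (by positivity)]
      linarith
    have hA'3 : A' ⊆ Metric.closedBall 0 3 := by
      rintro _ ⟨y, hy, rfl⟩
      rw [mem_closedBall_zero_iff]
      have h1 := mem_closedBall_iff_norm.1 (ha hy)
      have h2 := mem_closedBall_iff_norm.1 (ha hx)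
      have heq : y - g = (y - a) - (x - a) - (g - x) := by abel
      change ‖y - g‖ ≤ 3
      rw [heq]
      linarith [norm_sub_le ((y - a) - (x - a)) (g - x), norm_sub_le (y - a) (x - a)]
    have hmid : ∀ p ∈ A', ∀ q ∈ A', (2⁻¹ : ℝ) • (p + q) ∈ A' ∪ D \ A' := by
      intro p hp q hq
      rw [union_sdiff_self]
      exact Or.inr ⟨p + q, ⟨p, hp, q, hq, rfl⟩, rfl⟩
    have hballD : Metric.closedBall 0 (ρ / 4) ⊆ D := by
      intro z hz
      rw [mem_closedBall_zero_iff] at hz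
      obtain ⟨p, hp, q, hq, hpq⟩ := hball (z + g) (by
        rw [mem_closedBall_iff_norm, add_sub_cancel_right]; exact hz)
      refine ⟨(p - g) + (q - g), ⟨_, ⟨p, hp, rfl⟩, _, ⟨q, hq, rfl⟩, rfl⟩, ?_⟩
      have h2 : (p - g) + (q - g) = z + z := by
        calc (p - g) + (q - g) = (p + q) - (g + g) := by abel
          _ = _ := by
            rw [show p + q = z + g + (z + g) from hpq]
            abel
      simp only
      rw [h2, ← two_smul ℝ z, inv_smul_smul₀ two_ne_zero]
    have hvolA : volume A' = volume A := htr A g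
    have hAtop : volume A ≠ ⊤ := hA.measure_lt_top.ne
    have hDvol : volume D ≤ volume A + ENNReal.ofReal δ * volume A := by
      have hsum : A' + A' = (fun y => y - (g + g)) '' (A + A) := by
        ext y
        constructor
        · rintro ⟨_, ⟨p, hp, rfl⟩, _, ⟨q, hq, rfl⟩, rfl⟩
          exact ⟨p + q, ⟨p, hp, q, hq, rfl⟩, by simp only; abel⟩
        · rintro ⟨_, ⟨p, hp, q, hq, rfl⟩, rfl⟩
          exact ⟨_, ⟨p, hp, rfl⟩, _, ⟨q, hq, rfl⟩, by simp only; abel⟩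
      rw [Measure.addHaar_smul, Module.finrank_fin_fun, hsum, htr]
      calc _ ≤ ENNReal.ofReal |2⁻¹ ^ (d + 1)| *
            (ENNReal.ofReal (2 ^ (d + 1) + δ) * volume A) := by gcongr
        _ ≤ ENNReal.ofReal (1 + δ) * volume A := by
          rw [← mul_assoc, ← ENNReal.ofReal_mul (by positivity), abs_of_nonneg (by positivity)]
          gcongr
          rw [inv_pow, inv_mul_le_iff₀ (by positivity)]
          have : (1 : ℝ) ≤ 2 ^ (d + 1) := one_le_pow₀ one_le_two
          nlinarith
        _ = _ := by
          rw [ENNReal.ofReal_add zero_le_one hδ, ENNReal.ofReal_one, add_mul, one_mul]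
    have hEvol : volume (D \ A') ≤ ENNReal.ofReal δ * volume A := by
      rw [measure_sdiff hAD hA'c.measurableSet.nullMeasurableSet (by rwa [hvolA]), hvolA,
        tsub_le_iff_left]
      exact hDvol
    have h := hcore A' (D \ A') hA'3 hmid (measure_mono (sdiff_subset_sdiff_left hballD)) M
      (fun j => u j - g) fun j => ⟨u j, hu j, rfl⟩
    have hco : convexHull ℝ (range fun j => u j - g) =
        (fun y => y - g) '' convexHull ℝ (range u) := by
      have hr : (range fun j => u j - g) = (-g) +ᵥ range u := by
        ext y
        simp [mem_vadd_set, sub_eq_neg_add]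
      rw [hr, convexHull_vadd, ← image_vadd]
      exact image_congr fun y _ => (sub_eq_neg_add y g).symm
    rw [hco, htr, hvolA] at h
    calc _ ≤ _ := h
      _ ≤ volume A + ENNReal.ofReal C₁ * (ENNReal.ofReal δ * volume A) := by gcongr
      _ = ENNReal.ofReal (1 + C₁ * δ) * volume A := by
          rw [ENNReal.ofReal_add zero_le_one (by positivity), ENNReal.ofReal_mul hC₁,
            ENNReal.ofReal_one]
          ring
      _ ≤ _ := by
          gcongr
          have : 0 ≤ 2 ^ (d + 1) / (c * δ₀) := by positivity
          linarith
  · have hsub : convexHull ℝ (range u) ⊆ Metric.closedBall a 1 := by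
      refine convexHull_min ?_ (convex_closedBall a 1)
      rintro _ ⟨j, rfl⟩
      exact ha (hu j)
    calc _ ≤ volume (Metric.closedBall a 1) := measure_mono hsub
      _ = ENNReal.ofReal (2 ^ (d + 1)) := by
          rw [Real.volume_pi_closedBall a zero_le_one]
          simp
      _ = ENNReal.ofReal (2 ^ (d + 1) / c) * ENNReal.ofReal c := by
          rw [← ENNReal.ofReal_mul (by positivity), div_mul_cancel₀ _ hc.ne']
      _ ≤ _ := by
          gcongr
          have h1 : 2 ^ (d + 1) / c = 2 ^ (d + 1) / (c * δ₀) * δ₀ := by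
            field_simp
          have h2 : 2 ^ (d + 1) / (c * δ₀) * δ₀ ≤ 2 ^ (d + 1) / (c * δ₀) * δ := by gcongr
          have h3 : 0 ≤ C₁ * δ := by positivity
          rw [h1]
          linarith

theorem exists_volume_convexHull_range_le (d : ℕ) :
    ∃ C : ℝ, 0 < C ∧ ∀ A : Set (Fin (d + 1) → ℝ), IsCompact A → 0 < volume A → ∀ δ : ℝ,
      0 ≤ δ → δ < 1 → volume (A + A) ≤ ENNReal.ofReal (2 ^ (d + 1) + δ) * volume A →
      ∀ (M : ℕ) (u : Fin M → Fin (d + 1) → ℝ), (∀ j, u j ∈ A) →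
        volume (convexHull ℝ (range u)) ≤ ENNReal.ofReal (1 + C * δ) * volume A := by
  obtain ⟨c, hc, hnf⟩ := exists_normal_form (d + 1)
  obtain ⟨C, hC, h⟩ := exists_volume_convexHull_le_of_normalized d hc
  refine ⟨C, hC, fun A hA hA0 δ hδ hδ1 hd M u hu => ?_⟩
  have hAtop : volume A ≠ ⊤ := hA.measure_lt_top.ne
  obtain ⟨f, a, hfa, hcf⟩ := hnf A hA hA0 (hd.trans_lt (by
    apply ENNReal.mul_lt_mul_left hA0.ne' hAtop
    rw [ENNReal.ofReal_add (by positivity) hδ, ENNReal.ofReal_pow zero_le_two,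
      ENNReal.ofReal_ofNat]
    refine ENNReal.add_lt_add_left (by simp) ?_
    rwa [ENNReal.ofReal_lt_one]))
  obtain ⟨κ, hκ0, hκt, hκ⟩ := exists_volume_image_eq_mul f
  have hco : convexHull ℝ (range (f ∘ u)) = f '' convexHull ℝ (range u) := by
    rw [range_comp]
    exact (f.toLinearMap.image_convexHull _).symm
  have hsum : f '' A + f '' A = f '' (A + A) := (image_add f).symm
  have := h (f '' A) (hA.image f.toContinuousLinearEquiv.continuous) a
    (by rintro _ ⟨x, hx, rfl⟩; exact mem_closedBall_iff_norm.2 (hfa x hx)) hcf δ hδ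
    (by
      rw [hsum, hκ, hκ, mul_left_comm]
      gcongr)
    M (f ∘ u) fun j => ⟨u j, hu j, rfl⟩
  rw [hco, hκ, hκ, mul_left_comm] at this
  exact (ENNReal.mul_le_mul_iff_right hκ0 hκt).1 this

theorem volume_convexHull_range_le_of_measurable {d : ℕ} {C : ℝ}
    (h : ∀ A : Set (Fin (d + 1) → ℝ), IsCompact A → 0 < volume A → ∀ δ : ℝ,
      0 ≤ δ → δ < 1 → volume (A + A) ≤ ENNReal.ofReal (2 ^ (d + 1) + δ) * volume A →
      ∀ (M : ℕ) (u : Fin M → Fin (d + 1) → ℝ), (∀ j, u j ∈ A) →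
        volume (convexHull ℝ (range u)) ≤ ENNReal.ofReal (1 + C * δ) * volume A)
    {A : Set (Fin (d + 1) → ℝ)} (hA : MeasurableSet A) (hA0 : 0 < volume A)
    (hAt : volume A < ⊤) {δ : ℝ} (hδ : 0 ≤ δ) (hδ1 : δ < 1)
    (hd : volume (A + A) ≤ ENNReal.ofReal (2 ^ (d + 1) + δ) * volume A)
    {M : ℕ} {u : Fin M → Fin (d + 1) → ℝ} (hu : ∀ j, u j ∈ A) :
    volume (convexHull ℝ (range u)) ≤ ENNReal.ofReal (1 + C * δ) * volume A := by
  have key : ∀ δ' ∈ Ioo δ 1,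
      volume (convexHull ℝ (range u)) ≤ ENNReal.ofReal (1 + C * δ') * volume A := by
    rintro δ' ⟨hδ', hδ'1⟩
    have hp : (0 : ℝ) < 2 ^ (d + 1) := by positivity
    set q : ℝ := (2 ^ (d + 1) + δ) / (2 ^ (d + 1) + δ') with hq
    have hq1 : q < 1 := by
      rw [hq, div_lt_one (by linarith)]
      linarith
    have hlt : ENNReal.ofReal q * volume A < volume A := by
      conv_rhs => rw [← one_mul (volume A)]
      exact ENNReal.mul_lt_mul_left hA0.ne' hAt.ne (by rwa [ENNReal.ofReal_lt_one])
    obtain ⟨K₀, hK₀A, hK₀, hK₀v⟩ := hA.exists_lt_isCompact hlt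
    set K := K₀ ∪ range u with hK
    have hKc : IsCompact K := hK₀.union (finite_range u).isCompact
    have hKA : K ⊆ A := union_subset hK₀A (range_subset_iff.2 hu)
    have hKv : ENNReal.ofReal q * volume A < volume K :=
      hK₀v.trans_le (measure_mono subset_union_left)
    have hKd : volume (K + K) ≤ ENNReal.ofReal (2 ^ (d + 1) + δ') * volume K := by
      calc volume (K + K) ≤ volume (A + A) := measure_mono (add_subset_add hKA hKA)
        _ ≤ _ := hd
        _ = ENNReal.ofReal (2 ^ (d + 1) + δ') * (ENNReal.ofReal q * volume A) := by
            rw [← mul_assoc, ← ENNReal.ofReal_mul (by linarith), hq,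
              mul_div_cancel₀ _ (by linarith)]
        _ ≤ _ := by gcongr
    refine (h K hKc (zero_le.trans_lt hKv) δ' (by linarith) hδ'1 hKd M u
      fun j => Or.inr ⟨j, rfl⟩).trans ?_
    gcongr
  have htend : Filter.Tendsto (fun δ' : ℝ => ENNReal.ofReal (1 + C * δ') * volume A)
      (nhdsWithin δ (Ioi δ)) (nhds (ENNReal.ofReal (1 + C * δ) * volume A)) := by
    have hc : Continuous fun δ' : ℝ => ENNReal.ofReal (1 + C * δ') :=
      ENNReal.continuous_ofReal.comp (by fun_prop)
    exact ENNReal.Tendsto.mul_const ((hc.tendsto δ).mono_left nhdsWithin_le_nhds)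
      (Or.inr hAt.ne)
  refine ge_of_tendsto htend ?_
  filter_upwards [Ioo_mem_nhdsGT hδ1] with δ' hδ'
  exact key δ' hδ'

/-- The measure of a convex hull is approximated by hulls of finite subsets. -/
theorem volume_convexHull_le_of_finset {k : ℕ} {A : Set (Fin k → ℝ)} {B : ENNReal}
    (h : ∀ t : Finset (Fin k → ℝ), (t : Set (Fin k → ℝ)) ⊆ A →
      volume (convexHull ℝ (t : Set (Fin k → ℝ))) ≤ B) :
    volume (convexHull ℝ A) ≤ B := by
  classical
  let ι := {t : Finset (Fin k → ℝ) // (t : Set (Fin k → ℝ)) ⊆ A}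
  let U : ι → Set (Fin k → ℝ) := fun t => interior (convexHull ℝ (t.1 : Set (Fin k → ℝ)))
  have : Nonempty ι := ⟨⟨∅, by simp⟩⟩
  have hdir : Directed (· ⊆ ·) U := by
    intro s t
    refine ⟨⟨s.1 ∪ t.1, ?_⟩, ?_, ?_⟩
    · rw [Finset.coe_union]
      exact union_subset s.2 t.2
    · exact interior_mono (convexHull_mono (by simp))
    · exact interior_mono (convexHull_mono (by simp))
  have hcov : interior (convexHull ℝ A) ⊆ ⋃ t, U t := by
    intro x hx
    obtain ⟨b, hxb, hbA⟩ := exists_mem_interior_convexHull_affineBasis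
      (mem_interior_iff_mem_nhds.1 hx)
    have hv : ∀ i, ∃ t : Finset (Fin k → ℝ), (t : Set (Fin k → ℝ)) ⊆ A ∧
        b i ∈ convexHull ℝ (t : Set (Fin k → ℝ)) := by
      intro i
      have hi : b i ∈ convexHull ℝ A := hbA (subset_convexHull ℝ _ ⟨i, rfl⟩)
      rw [convexHull_eq_union_convexHull_finite_subsets] at hi
      obtain ⟨t, ht, hbt⟩ := mem_iUnion₂.1 hi
      exact ⟨t, ht, hbt⟩
    choose t htA hbt using hv
    refine mem_iUnion.2 ⟨⟨Finset.univ.biUnion t, ?_⟩, interior_mono (convexHull_min ?_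
      (convex_convexHull ℝ _)) hxb⟩
    · simpa using htA
    · rintro _ ⟨i, rfl⟩
      refine convexHull_mono ?_ (hbt i)
      exact_mod_cast Finset.subset_biUnion_of_mem t (Finset.mem_univ i)
  have hInterior : volume (interior (convexHull ℝ A)) ≤ B := by
    rw [isOpen_interior.measure_eq_iSup_isCompact]
    refine iSup₂_le fun L hL => iSup_le fun hLc => ?_
    obtain ⟨t, ht⟩ := hLc.elim_directed_cover U (fun _ => isOpen_interior) (hL.trans hcov) hdir
    exact (measure_mono (ht.trans interior_subset)).trans (h t.1 t.2)
  calc volume (convexHull ℝ A)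
      ≤ volume (interior (convexHull ℝ A) ∪ frontier (convexHull ℝ A)) := by
        rw [← closure_eq_interior_union_frontier]
        exact measure_mono subset_closure
    _ ≤ volume (interior (convexHull ℝ A)) + volume (frontier (convexHull ℝ A)) :=
        measure_union_le _ _
    _ ≤ B := by
        rw [(convex_convexHull ℝ A).addHaar_frontier volume, add_zero]
        exact hInterior

theorem stmt_6 (k : ℕ) (hk : 1 ≤ k) :
    ∃ C : ℝ, 0 < C ∧
      ∀ A : Set (Fin k → ℝ), MeasurableSet A → 0 < volume A → volume A < ⊤ →
        ∀ δ : ℝ, δ ∈ Set.Ico (0 : ℝ) 1 →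
          volume (A + A) ≤ ENNReal.ofReal (2 ^ k + δ) * volume A →
          volume (convexHull ℝ A \ A) ≤ ENNReal.ofReal (C * δ) * volume A := by
  obtain ⟨d, rfl⟩ : ∃ d, k = d + 1 := ⟨k - 1, by omega⟩
  obtain ⟨C, hC, h⟩ := exists_volume_convexHull_range_le d
  refine ⟨C, hC, fun A hA hA0 hAt δ hδ hd => ?_⟩
  have hco : volume (convexHull ℝ A) ≤ ENNReal.ofReal (1 + C * δ) * volume A := by
    refine volume_convexHull_le_of_finset fun t ht => ?_
    have hr : range (fun j => (t.equivFin.symm j : Fin (d + 1) → ℝ)) = t := by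
      rw [← Function.comp_def, EquivLike.range_comp Subtype.val t.equivFin.symm]
      simp
    rw [← hr]
    exact volume_convexHull_range_le_of_measurable h hA hA0 hAt hδ.1 hδ.2 hd
      fun j => ht (t.equivFin.symm j).2
  rw [measure_sdiff (subset_convexHull ℝ A) hA.nullMeasurableSet hAt.ne, tsub_le_iff_left]
  refine hco.trans_eq ?_
  rw [ENNReal.ofReal_add zero_le_one (mul_nonneg hC.le hδ.1), ENNReal.ofReal_one, add_mul,
    one_mul]
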